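/- Let λ be a k-bounded partition and α a k-bounded composition with |α| = |λ|. Then every T ∈ 𝒯^k_α(λ) has all its cells filled with singleton sets, and the map that replaces each letter of 𝒜_{α,x} by x (for every x) is a bijection from 𝒯^k_α(λ) onto the set of k-tableaux of shape 𝔠(λ) and weight α; in particular 𝒦^{(k)}_{λα} = K^{(k)}_{λα}. -/

import Mathlib

open scoped Classical

namespace AffineKTheory

noncomputable instance : Nonempty YoungDiagram := ⟨⊥⟩

noncomputable instance : Nonempty YoungDiagram := ⟨⊥⟩

/-! ## Cells, hooks, cores, residues -/

/-- Hook length of the cell `(r, c)` in the diagram `γ`. -/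
def hookLen (γ : YoungDiagram) (r c : ℕ) : ℕ :=
  (γ.rowLen r - c) + (γ.colLen c - r) - 1

/-- A `p`-core: a diagram none of whose cells has hook length `p`. -/
def IsCore (p : ℕ) (γ : YoungDiagram) : Prop :=
  ∀ c : ℕ × ℕ, c ∈ γ → hookLen γ c.1 c.2 ≠ p

/-- The `(k+1)`-residue of a cell.  (Rows of the Ferrers shape are indexed so that the cell
directly above `(r, c)` -- in the Ferrers sense of the next, shorter, row -- is `(r+1, c)`.) -/
def residue (k : ℕ) (c : ℕ × ℕ) : ZMod (k + 1) :=
  (c.2 : ZMod (k + 1)) - (c.1 : ZMod (k + 1))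

/-- A removable corner of `γ`: a cell of `γ` with no cell above it nor to its right. -/
def Removable (γ : YoungDiagram) (c : ℕ × ℕ) : Prop :=
  c ∈ γ ∧ (c.1 + 1, c.2) ∉ γ ∧ (c.1, c.2 + 1) ∉ γ

/-- An addable corner of `γ`: a cell outside `γ` whose addition again yields a partition shape. -/
def Addable (γ : YoungDiagram) (c : ℕ × ℕ) : Prop :=
  c ∉ γ ∧ ∀ d : ℕ × ℕ, d ≤ c → d ≠ c → d ∈ γ

/-- A cell is `γ`-blocked if it lies below a cell of `γ`. -/
def Blocked (γ : YoungDiagram) (c : ℕ × ℕ) : Prop :=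
  (c.1 + 1, c.2) ∈ γ

/-- The number of cells of `γ` in row `i` whose hook length is at most `k`:
the `i`-th part of `𝔭(γ)`. -/
noncomputable def pRow (k : ℕ) (γ : YoungDiagram) (i : ℕ) : ℕ :=
  (γ.cells.filter (fun c => c.1 = i ∧ hookLen γ c.1 c.2 ≤ k)).card

/-- The number of cells of `γ` with `k`-bounded hook length, i.e. `|𝔭(γ)|`. -/
noncomputable def pSize (k : ℕ) (γ : YoungDiagram) : ℕ :=
  (γ.cells.filter (fun c => hookLen γ c.1 c.2 ≤ k)).card

/-- A `k`-bounded partition: all parts at most `k`. -/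
def IsKBounded (k : ℕ) (lam : YoungDiagram) : Prop :=
  ∀ i, lam.rowLen i ≤ k

/-- `𝔭(γ)`: the `k`-bounded partition obtained from a `(k+1)`-core `γ` by deleting every cell of
hook length greater than `k` and reading off row lengths. -/
noncomputable def pPart (k : ℕ) (γ : YoungDiagram) : YoungDiagram :=
  Classical.epsilon fun lam => ∀ i, lam.rowLen i = pRow k γ i

/-- `𝔠(λ)`: the unique `(k+1)`-core corresponding to the `k`-bounded partition `λ` under the
bijection `𝔭`. -/
noncomputable def coreOf (k : ℕ) (lam : YoungDiagram) : YoungDiagram :=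
  Classical.epsilon fun γ => IsCore (k + 1) γ ∧ ∀ i, pRow k γ i = lam.rowLen i

/-- The `k`-conjugate `λ^{ω_k} = 𝔭(𝔠(λ)')` of a `k`-bounded partition. -/
noncomputable def kConj (k : ℕ) (lam : YoungDiagram) : YoungDiagram :=
  pPart k ((coreOf k lam).transpose)

/-- A `k`-bounded composition: a list of parts, each between `1` and `k`. -/
def IsKBoundedComp (k : ℕ) (α : List ℕ) : Prop :=
  ∀ a ∈ α, 1 ≤ a ∧ a ≤ k

/-- Dominance order on partitions. -/
def Dominates (mu lam : YoungDiagram) : Prop :=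
  mu.card = lam.card ∧
    ∀ n : ℕ, ∑ i ∈ Finset.range n, lam.rowLen i ≤ ∑ i ∈ Finset.range n, mu.rowLen i


/-! ## Set-valued fillings and affine set-valued tableaux -/

/-- A set-valued filling of the shape `γ`: each cell of `γ` carries a finite nonempty set of
positive integers, empty outside `γ`, with `max X < min Y` when `X` is directly below `Y` and
`max X ≤ min Y` when `X` is directly to the left of `Y`. -/
def IsSVFilling (γ : YoungDiagram) (e : ℕ × ℕ → Finset ℕ) : Prop :=
  (∀ c : ℕ × ℕ, c ∈ γ ↔ (e c).Nonempty) ∧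
  (∀ c : ℕ × ℕ, ∀ x ∈ e c, 0 < x) ∧
  (∀ r c : ℕ, ∀ x ∈ e (r, c), ∀ y ∈ e (r + 1, c), x < y) ∧
  (∀ r c : ℕ, ∀ x ∈ e (r, c), ∀ y ∈ e (r, c + 1), x ≤ y)

/-- The set of cells of `T_{≤ x}`: cells containing a letter `≤ x`. -/
noncomputable def shapeLe (γ : YoungDiagram) (e : ℕ × ℕ → Finset ℕ) (x : ℕ) : Finset (ℕ × ℕ) :=
  γ.cells.filter fun c => ∃ y ∈ e c, y ≤ x

/-- A standard affine set-valued tableau of degree `n` and shape `γ`: a set-valued filling with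
letters `1, …, n` such that for each `x`, the shape of `T_{≤x}` is a `(k+1)`-core and the letter
`x` occupies exactly all of its removable corners of one single residue. -/
def IsStdASVT (k n : ℕ) (γ : YoungDiagram) (e : ℕ × ℕ → Finset ℕ) : Prop :=
  IsSVFilling γ e ∧
  (∀ c : ℕ × ℕ, ∀ y ∈ e c, y ≤ n) ∧
  ∀ x : ℕ, 1 ≤ x → x ≤ n →
    ∃ δ : YoungDiagram, IsCore (k + 1) δ ∧ δ.cells = shapeLe γ e x ∧
      ∃ i : ZMod (k + 1), (∃ c, x ∈ e c) ∧
        ∀ c : ℕ × ℕ, x ∈ e c ↔ Removable δ c ∧ residue k c = i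

/-- The alphabet `𝒜_{α,x} = {Σ^{x-1}α + 1, …, Σ^x α}`. -/
def alphaBlock (α : List ℕ) (x : ℕ) : Finset ℕ :=
  Finset.Ioc ((α.take (x - 1)).sum) ((α.take x).sum)

/-- `c` is the lowest occurrence of the letter `y`. -/
def IsLowestOcc (e : ℕ × ℕ → Finset ℕ) (y : ℕ) (c : ℕ × ℕ) : Prop :=
  y ∈ e c ∧ ∀ d : ℕ × ℕ, y ∈ e d → c.1 ≤ d.1

/-- `a` comes strictly before `b` in the reading order (top to bottom, left to right;
higher rows of the Ferrers shape have larger first coordinate here). -/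
def ReadBefore (a b : ℕ × ℕ) : Prop :=
  b.1 < a.1 ∨ (a.1 = b.1 ∧ a.2 < b.2)

/-- An affine set-valued tableau of weight `α` and shape `γ`: a standard affine set-valued
tableau of degree `|α|` such that for each `x`, the lowest reading word in `𝒜_{α,x}` is
increasing, the letters of `𝒜_{α,x}` occupy exactly `α_x` distinct residues, and they form a
horizontal strip. -/
def IsASVT (k : ℕ) (α : List ℕ) (γ : YoungDiagram) (e : ℕ × ℕ → Finset ℕ) : Prop :=
  IsStdASVT k α.sum γ e ∧
  ∀ x : ℕ, 1 ≤ x → x ≤ α.length →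
    (∀ y z : ℕ, y ∈ alphaBlock α x → z ∈ alphaBlock α x → y < z →
      ∀ cy cz : ℕ × ℕ, IsLowestOcc e y cy → IsLowestOcc e z cz → ReadBefore cy cz) ∧
    (((γ.cells.filter fun c => ∃ y ∈ alphaBlock α x, y ∈ e c).image (residue k)).card
        = α.getD (x - 1) 0) ∧
    (∀ c d : ℕ × ℕ, (∃ y ∈ alphaBlock α x, y ∈ e c) → (∃ y ∈ alphaBlock α x, y ∈ e d) →
      c.2 = d.2 → c = d)

/-- `𝒦^{(k)}_{λα}`: the number of affine set-valued tableaux of shape `𝔠(λ)` and weight `α`. -/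
noncomputable def Kcal (k : ℕ) (lam : YoungDiagram) (α : List ℕ) : ℕ :=
  Nat.card {e : ℕ × ℕ → Finset ℕ // IsASVT k α (coreOf k lam) e}

/-- A `k`-tableau of shape `γ` and weight `α`: a semistandard filling with letters `1,…,ℓ(α)`
(recorded as `0` outside `γ`) in which the letter `i` occupies exactly `α_i` distinct residues. -/
def IsKTab (k : ℕ) (α : List ℕ) (γ : YoungDiagram) (u : ℕ × ℕ → ℕ) : Prop :=
  (∀ c : ℕ × ℕ, c ∈ γ ↔ u c ≠ 0) ∧
  (∀ c : ℕ × ℕ, u c ≤ α.length) ∧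
  (∀ r c : ℕ, (r, c) ∈ γ → (r + 1, c) ∈ γ → u (r, c) < u (r + 1, c)) ∧
  (∀ r c : ℕ, (r, c) ∈ γ → (r, c + 1) ∈ γ → u (r, c) ≤ u (r, c + 1)) ∧
  ∀ i : ℕ, 1 ≤ i → i ≤ α.length →
    ((γ.cells.filter fun c => u c = i).image (residue k)).card = α.getD (i - 1) 0

/-- `K^{(k)}_{λα}`: the number of `k`-tableaux of shape `𝔠(λ)` and weight `α`. -/
noncomputable def Kktab (k : ℕ) (lam : YoungDiagram) (α : List ℕ) : ℕ :=
  Nat.card {u : ℕ × ℕ → ℕ // IsKTab k α (coreOf k lam) u}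

/-- A plain set-valued tableau of shape `λ` and weight `α`. -/
def IsSVT (α : List ℕ) (lam : YoungDiagram) (e : ℕ × ℕ → Finset ℕ) : Prop :=
  IsSVFilling lam e ∧ (∀ c : ℕ × ℕ, ∀ x ∈ e c, x ≤ α.length) ∧
  ∀ i : ℕ, 1 ≤ i → i ≤ α.length →
    (lam.cells.filter fun c => i ∈ e c).card = α.getD (i - 1) 0

/-- `𝒦_{λα}`: the number of set-valued tableaux of shape `λ` and weight `α`. -/
noncomputable def KcalSV (lam : YoungDiagram) (α : List ℕ) : ℕ :=
  Nat.card {e : ℕ × ℕ → Finset ℕ // IsSVT α lam e}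



/-! ## Coefficient series of affine Grothendieck polynomials and dual k-Schur functions -/

/-- The coefficient of `m_ν` in the affine Grothendieck polynomial
`G^{(k)}_λ = Σ_{μ ∈ 𝒫^k} (-1)^{|λ|+|μ|} 𝒦^{(k)}_{λμ} m_μ`
(a degree-wise finite formal series in the monomial symmetric functions). -/
noncomputable def Gcoeff (k : ℕ) (lam ν : YoungDiagram) : ℤ :=
  if IsKBounded k ν then (-1) ^ (lam.card + ν.card) * (Kcal k lam ν.rowLens : ℤ) else 0

/-- The coefficient of `m_ν` in the dual `k`-Schur function
`𝔖^{(k)}_λ = Σ_{μ ∈ 𝒫^k} K^{(k)}_{λμ} m_μ`. -/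
noncomputable def dualKSchurCoeff (k : ℕ) (lam ν : YoungDiagram) : ℤ :=
  if IsKBounded k ν then (Kktab k lam ν.rowLens : ℤ) else 0

/-- `blockOf α y = x` when `y ∈ 𝒜_{α,x}`: the map replacing each letter of `𝒜_{α,x}` by `x`. -/
noncomputable def blockOf (α : List ℕ) (y : ℕ) : ℕ :=
  sInf {x : ℕ | y ≤ (α.take x).sum}


/-! ## Beads of a diagram -/

/-- `z` is a bead of the edge sequence of `γ`: it is `γ_i - i` for some row `i`. -/
def IsBead (γ : YoungDiagram) (z : ℤ) : Prop :=
  ∃ i : ℕ, (γ.rowLen i : ℤ) - i = z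

theorem mem_iff_row {γ : YoungDiagram} {i j : ℕ} : (i, j) ∈ γ ↔ j < γ.rowLen i :=
  YoungDiagram.mem_iff_lt_rowLen

theorem mem_iff_col {γ : YoungDiagram} {i j : ℕ} : (i, j) ∈ γ ↔ i < γ.colLen j :=
  YoungDiagram.mem_iff_lt_colLen

theorem lt_rowLen_iff_lt_colLen {γ : YoungDiagram} {i j : ℕ} :
    j < γ.rowLen i ↔ i < γ.colLen j := by
  rw [← mem_iff_row, mem_iff_col]

theorem bead_strictAnti (γ : YoungDiagram) {i i' : ℕ} (h : i < i') :
    (γ.rowLen i' : ℤ) - i' < (γ.rowLen i : ℤ) - i := by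
  have := γ.rowLen_anti i i' h.le
  omega

theorem colGap_not_isBead (γ : YoungDiagram) (j : ℕ) :
    ¬ IsBead γ ((j : ℤ) + 1 - γ.colLen j) := by
  rintro ⟨i, hi⟩
  have h := lt_rowLen_iff_lt_colLen (γ := γ) (i := i) (j := j)
  by_cases h1 : j < γ.rowLen i
  · have := h.1 h1
    omega
  · have : ¬ i < γ.colLen j := fun h2 => h1 (h.2 h2)
    omega

theorem exists_colGap {γ : YoungDiagram} {g : ℤ} (hg : ¬ IsBead γ g) :
    ∃ j : ℕ, (j : ℤ) + 1 - γ.colLen j = g := by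
  have hex : ∃ i : ℕ, (γ.rowLen i : ℤ) - i < g := by
    refine ⟨γ.rowLen 0 + g.natAbs + 1, ?_⟩
    have := γ.rowLen_anti 0 (γ.rowLen 0 + g.natAbs + 1) (Nat.zero_le _)
    have := neg_abs_le g
    push_cast
    omega
  have h1 := Nat.find_spec hex
  have h2 : ∀ m < Nat.find hex, ¬ ((γ.rowLen m : ℤ) - m < g) := fun m hm => Nat.find_min hex hm
  set i := Nat.find hex with hi
  have hj : 0 ≤ g + i - 1 := by omega
  refine ⟨(g + i - 1).toNat, ?_⟩
  have hcol : γ.colLen (g + i - 1).toNat = i := by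
    apply le_antisymm
    · by_contra! hlt
      have := lt_rowLen_iff_lt_colLen.2 hlt
      omega
    · by_contra! hlt
      have h3 := h2 (i - 1) (by omega)
      have h5 : (γ.rowLen (i - 1) : ℤ) - (i - 1 : ℕ) ≠ g := fun h => hg ⟨_, h⟩
      have h4 : i - 1 < γ.colLen (g + i - 1).toNat := by
        rw [← lt_rowLen_iff_lt_colLen]
        omega
      omega
  rw [hcol]
  omega

theorem hookLen_eq {γ : YoungDiagram} {i j : ℕ} (h : (i, j) ∈ γ) :
    (hookLen γ i j : ℤ) = ((γ.rowLen i : ℤ) - i) - ((j : ℤ) + 1 - γ.colLen j) := by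
  have h1 := mem_iff_row.1 h
  have h2 := mem_iff_col.1 h
  unfold hookLen
  omega

theorem isCore_iff_bead {p : ℕ} (hp : 1 ≤ p) {γ : YoungDiagram} :
    IsCore p γ ↔ ∀ z, IsBead γ z → IsBead γ (z - p) := by
  constructor
  · rintro hc z ⟨i, rfl⟩
    by_contra hg
    obtain ⟨j, hj⟩ := exists_colGap hg
    have hmem : (i, j) ∈ γ := by
      rw [mem_iff_row]
      have h := lt_rowLen_iff_lt_colLen (γ := γ) (i := i) (j := j)
      by_contra h1
      have : ¬ i < γ.colLen j := fun h2 => h1 (h.2 h2)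
      omega
    have := hookLen_eq hmem
    exact hc (i, j) hmem (by simp only; omega)
  · rintro hb ⟨i, j⟩ hmem heq
    have := hookLen_eq hmem
    simp only at heq
    apply colGap_not_isBead γ j
    have h2 := hb _ ⟨i, rfl⟩
    convert h2 using 1
    omega

theorem bead_of_le {k : ℕ} {γ : YoungDiagram} (hc : IsCore (k + 1) γ) {z w : ℤ}
    (hz : IsBead γ z) (hle : w ≤ z) (hres : (w : ZMod (k + 1)) = z) : IsBead γ w := by
  rw [isCore_iff_bead (by omega)] at hc
  obtain ⟨t, ht⟩ := (ZMod.intCast_eq_intCast_iff_dvd_sub _ _ _).1 hres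
  have key : ∀ n : ℕ, IsBead γ (z - n * ((k + 1 : ℕ) : ℤ)) := by
    intro n
    induction n with
    | zero => simpa using hz
    | succ n ih =>
      have := hc _ ih
      convert this using 1
      push_cast
      ring
  have ht0 : 0 ≤ t := by
    by_contra! h
    have : ((k + 1 : ℕ) : ℤ) * t < 0 := mul_neg_of_pos_of_neg (by positivity) h
    omega
  have := key t.toNat
  convert this using 1
  rw [Int.toNat_of_nonneg ht0, mul_comm t]
  omega

theorem residue_eq (k : ℕ) (c : ℕ × ℕ) :
    residue k c = (((c.2 : ℤ) - (c.1 : ℤ) : ℤ) : ZMod (k + 1)) := by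
  simp [residue]

theorem Removable.rowLen_eq {γ : YoungDiagram} {c : ℕ × ℕ} (h : Removable γ c) :
    γ.rowLen c.1 = c.2 + 1 := by
  have h1 := mem_iff_row.1 (show (c.1, c.2) ∈ γ from h.1)
  have h2 := mt mem_iff_row.2 h.2.2
  omega

theorem Removable.isBead {γ : YoungDiagram} {c : ℕ × ℕ} (h : Removable γ c) :
    IsBead γ ((c.2 : ℤ) - c.1 + 1) := by
  refine ⟨c.1, ?_⟩
  rw [h.rowLen_eq]
  push_cast
  ring

theorem Removable.not_isBead {γ : YoungDiagram} {c : ℕ × ℕ} (h : Removable γ c) :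
    ¬ IsBead γ ((c.2 : ℤ) - c.1) := by
  rintro ⟨i, hi⟩
  have h1 := h.rowLen_eq
  have h2 := mt mem_iff_row.2 h.2.1
  rcases lt_trichotomy i (c.1 + 1) with hlt | rfl | hgt
  · rcases (Nat.lt_succ_iff.1 hlt).eq_or_lt with rfl | hlt'
    · omega
    · have := bead_strictAnti γ hlt'
      omega
  · push_cast at hi
    omega
  · have := bead_strictAnti γ hgt
    push_cast at this
    omega

theorem removable_of_bead {γ : YoungDiagram} {i : ℕ}
    (h : ¬ IsBead γ ((γ.rowLen i : ℤ) - i - 1)) :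
    γ.rowLen (i + 1) < γ.rowLen i ∧ Removable γ (i, γ.rowLen i - 1) := by
  have h1 : γ.rowLen (i + 1) < γ.rowLen i := by
    have h2 := γ.rowLen_anti i (i + 1) (Nat.le_succ i)
    have h3 : γ.rowLen (i + 1) ≠ γ.rowLen i := by
      intro h3
      exact h ⟨i + 1, by rw [h3]; push_cast; ring⟩
    omega
  refine ⟨h1, ?_, ?_, ?_⟩
  · exact mem_iff_row.2 (by omega)
  · simp only
    rw [mem_iff_row]
    omega
  · simp only
    rw [mem_iff_row]
    omega

theorem Addable.rowLen_eq {γ : YoungDiagram} {c : ℕ × ℕ} (h : Addable γ c) :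
    γ.rowLen c.1 = c.2 := by
  have h1 : ¬ c.2 < γ.rowLen c.1 := mt mem_iff_row.2 h.1
  by_contra hne
  have h2 := h.2 (c.1, γ.rowLen c.1) (Prod.mk_le_mk.2 ⟨le_rfl, by omega⟩)
    (fun he => hne (congrArg Prod.snd he))
  rw [mem_iff_row] at h2
  omega

theorem Addable.isBead {γ : YoungDiagram} {c : ℕ × ℕ} (h : Addable γ c) :
    IsBead γ ((c.2 : ℤ) - c.1) :=
  ⟨c.1, by rw [h.rowLen_eq]⟩

theorem Addable.not_isBead {γ : YoungDiagram} {c : ℕ × ℕ} (h : Addable γ c) :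
    ¬ IsBead γ ((c.2 : ℤ) - c.1 + 1) := by
  rintro ⟨i, hi⟩
  have h1 := h.rowLen_eq
  rcases lt_or_ge i c.1 with hlt | hge
  · have h2 : (c.1 - 1, c.2) ∈ γ := h.2 _ (Prod.mk_le_mk.2 ⟨by omega, le_rfl⟩)
      (fun he => by have := congrArg Prod.fst he; simp only at this; omega)
    rw [mem_iff_row] at h2
    rcases (show i ≤ c.1 - 1 by omega).eq_or_lt with rfl | hlt'
    · omega
    · have := bead_strictAnti γ hlt'
      omega
  · rcases hge.eq_or_lt with rfl | hgt
    · omega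
    · have := bead_strictAnti γ hgt
      omega

/-- A core does not have a removable and an addable corner of the same residue. -/
theorem IsCore.not_removable_addable {k : ℕ} {γ : YoungDiagram} (hc : IsCore (k + 1) γ)
    {c d : ℕ × ℕ} (h : Removable γ c) (h' : Addable γ d) : residue k c ≠ residue k d := by
  intro he
  rw [residue_eq, residue_eq] at he
  rcases le_total ((d.2 : ℤ) - d.1) ((c.2 : ℤ) - c.1) with hle | hle
  · refine h'.not_isBead (bead_of_le hc h.isBead (by omega) ?_)
    push_cast at he ⊢
    rw [he]
  · exact h.not_isBead (bead_of_le hc h'.isBead hle he)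

/-! ## Removing all corners of one residue -/

/-- The diagram obtained from `γ` by deleting all its removable corners of residue `r`. -/
noncomputable def removeRes (k : ℕ) (r : ZMod (k + 1)) (γ : YoungDiagram) : YoungDiagram where
  cells := γ.cells.filter fun c => ¬ (Removable γ c ∧ residue k c = r)
  isLowerSet := by
    intro c d hdc hc
    simp only [Finset.coe_filter, Set.mem_ofPred_eq, YoungDiagram.mem_cells] at hc ⊢
    refine ⟨γ.isLowerSet hdc hc.1, fun hd => hc.2 ?_⟩
    have : d = c := by
      obtain ⟨c1, c2⟩ := c
      obtain ⟨d1, d2⟩ := d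
      obtain ⟨h1, h2⟩ := Prod.mk_le_mk.1 hdc
      by_contra hne
      rcases h1.eq_or_lt with rfl | h1
      · have h3 : d2 < c2 := lt_of_le_of_ne h2 (fun h => hne (by rw [h]))
        exact hd.1.2.2 (γ.isLowerSet (Prod.mk_le_mk.2 ⟨le_rfl, h3⟩) hc.1)
      · exact hd.1.2.1 (γ.isLowerSet (Prod.mk_le_mk.2 ⟨h1, h2⟩) hc.1)
    exact this ▸ hd

theorem mem_removeRes {k : ℕ} {r : ZMod (k + 1)} {γ : YoungDiagram} {c : ℕ × ℕ} :
    c ∈ removeRes k r γ ↔ c ∈ γ ∧ ¬ (Removable γ c ∧ residue k c = r) := by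
  rw [← YoungDiagram.mem_cells]
  simp [removeRes]

theorem rowLen_eq_of_forall {γ : YoungDiagram} {i n : ℕ} (h : ∀ j, (i, j) ∈ γ ↔ j < n) :
    γ.rowLen i = n := by
  apply le_antisymm
  · by_contra! hlt
    exact lt_irrefl _ ((h n).1 (mem_iff_row.2 hlt))
  · by_contra! hlt
    exact lt_irrefl _ (mem_iff_row.1 ((h _).2 hlt))

/-- Rows of `removeRes`, in terms of beads. -/
theorem rowLen_removeRes (k : ℕ) (r : ZMod (k + 1)) (γ : YoungDiagram) (i : ℕ) :
    ((removeRes k r γ).rowLen i : ℤ) - i =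
      if (((γ.rowLen i : ℤ) - i : ℤ) : ZMod (k + 1)) = r + 1 ∧
          ¬ IsBead γ ((γ.rowLen i : ℤ) - i - 1)
      then (γ.rowLen i : ℤ) - i - 1 else (γ.rowLen i : ℤ) - i := by
  split_ifs with h
  · obtain ⟨hlt, hrem⟩ := removable_of_bead h.2
    have : (removeRes k r γ).rowLen i = γ.rowLen i - 1 := by
      apply rowLen_eq_of_forall
      intro j
      rw [mem_removeRes, mem_iff_row]
      constructor
      · rintro ⟨h1, h2⟩
        by_contra h3
        obtain rfl : j = γ.rowLen i - 1 := by omega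
        refine h2 ⟨hrem, ?_⟩
        rw [residue_eq]
        simp only
        rw [show (((γ.rowLen i - 1 : ℕ) : ℤ) - i) = ((γ.rowLen i : ℤ) - i) - 1 by omega]
        rw [Int.cast_sub, h.1]
        simp
      · intro h1
        refine ⟨by omega, fun h2 => ?_⟩
        have := h2.1.rowLen_eq
        simp only at this
        omega
    rw [this]
    omega
  · have : (removeRes k r γ).rowLen i = γ.rowLen i := by
      apply rowLen_eq_of_forall
      intro j
      rw [mem_removeRes, mem_iff_row]
      refine ⟨fun h1 => h1.1, fun h1 => ⟨h1, fun h2 => h ?_⟩⟩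
      have h3 := h2.1.rowLen_eq
      have h4 := h2.1.not_isBead
      have h5 := h2.2
      rw [residue_eq] at h5
      simp only at h3 h4 h5
      rw [show ((γ.rowLen i : ℤ) - i) = ((j : ℤ) - i) + 1 by omega]
      refine ⟨?_, by simpa using h4⟩
      rw [Int.cast_add, h5]
      simp
    rw [this]

theorem isBead_removeRes {k : ℕ} {r : ZMod (k + 1)} {γ : YoungDiagram} {z : ℤ} :
    IsBead (removeRes k r γ) z ↔
      (IsBead γ z ∧ ¬ ((z : ZMod (k + 1)) = r + 1 ∧ ¬ IsBead γ (z - 1))) ∨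
      (IsBead γ (z + 1) ∧ (z : ZMod (k + 1)) = r ∧ ¬ IsBead γ z) := by
  constructor
  · rintro ⟨i, hi⟩
    rw [rowLen_removeRes] at hi
    split_ifs at hi with h
    · right
      refine ⟨⟨i, by omega⟩, ?_, ?_⟩
      · rw [← hi, Int.cast_sub, h.1]
        simp
      · rw [← hi]
        exact h.2
    · left
      rw [hi] at h
      exact ⟨⟨i, hi⟩, h⟩
  · rintro (⟨⟨i, hi⟩, h⟩ | ⟨⟨i, hi⟩, h, h'⟩)
    · refine ⟨i, ?_⟩
      rw [rowLen_removeRes, hi, if_neg h]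
    · refine ⟨i, ?_⟩
      rw [rowLen_removeRes, hi, if_pos]
      · ring
      · refine ⟨?_, by simpa using h'⟩
        rw [Int.cast_add, h]
        simp

theorem add_one_ne_self_zmod {k : ℕ} (hk : 1 ≤ k) (r : ZMod (k + 1)) : r + 1 ≠ r := by
  have : Fact (1 < k + 1) := ⟨by omega⟩
  intro h
  exact one_ne_zero (add_eq_left.1 h)

theorem cast_succ_eq_zero (k : ℕ) : (((k + 1 : ℕ) : ℤ) : ZMod (k + 1)) = 0 := by
  rw [Int.cast_natCast]
  exact ZMod.natCast_self (k + 1)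

theorem isCore_removeRes {k : ℕ} (hk : 1 ≤ k) (r : ZMod (k + 1)) {γ : YoungDiagram}
    (hc : IsCore (k + 1) γ) : IsCore (k + 1) (removeRes k r γ) := by
  rw [isCore_iff_bead (by omega)] at hc ⊢
  intro z hz
  have hcast : ((z - ((k + 1 : ℕ) : ℤ) : ℤ) : ZMod (k + 1)) = z := by
    rw [Int.cast_sub, cast_succ_eq_zero, sub_zero]
  rw [isBead_removeRes] at hz ⊢
  rw [hcast]
  rcases hz with ⟨h1, h2⟩ | ⟨h1, h2, h3⟩
  · refine Or.inl ⟨hc _ h1, fun h => h2 ⟨h.1, fun h4 => h.2 ?_⟩⟩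
    convert hc _ h4 using 1
    ring
  · by_cases h4 : IsBead γ (z - ((k + 1 : ℕ) : ℤ))
    · exact Or.inl ⟨h4, fun h => add_one_ne_self_zmod hk r (h.1.symm.trans h2)⟩
    · refine Or.inr ⟨?_, h2, h4⟩
      convert hc _ h1 using 1
      ring

/-- In a core with a removable corner of residue `r`, every bead of residue `r` is followed by
a bead. -/
theorem IsCore.bead_succ {k : ℕ} {γ : YoungDiagram} (hc : IsCore (k + 1) γ) {c : ℕ × ℕ}
    (hrem : Removable γ c) {z : ℤ} (hz : IsBead γ z) (hres : (z : ZMod (k + 1)) = residue k c) :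
    IsBead γ (z + 1) := by
  rw [residue_eq] at hres
  rcases le_or_gt ((c.2 : ℤ) - c.1) z with hle | hlt
  · exact absurd (bead_of_le hc hz hle hres.symm) hrem.not_isBead
  · refine bead_of_le hc hrem.isBead (by omega) ?_
    rw [Int.cast_add, Int.cast_add, hres]

/-! ## The size statistic -/

theorem pRow_eq_card (k : ℕ) (γ : YoungDiagram) (i : ℕ) :
    pRow k γ i = ((Finset.Icc 1 k).filter
      fun j : ℕ => ¬ IsBead γ ((γ.rowLen i : ℤ) - i - j)).card := by
  unfold pRow
  apply Finset.card_bij (fun c _ => hookLen γ c.1 c.2)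
  · rintro ⟨i', j⟩ hc
    simp only [Finset.mem_filter, YoungDiagram.mem_cells, Finset.mem_Icc] at hc ⊢
    obtain ⟨hmem, rfl, hle⟩ := hc
    have h1 := hookLen_eq hmem
    have h2 := mem_iff_row.1 hmem
    have h3 := mem_iff_col.1 hmem
    refine ⟨⟨by omega, hle⟩, ?_⟩
    rw [h1]
    convert colGap_not_isBead γ j using 2
    ring
  · rintro ⟨i1, j1⟩ h1 ⟨i2, j2⟩ h2 he
    simp only [Finset.mem_filter, YoungDiagram.mem_cells] at h1 h2
    obtain ⟨hm1, rfl, -⟩ := h1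
    obtain ⟨hm2, h12, -⟩ := h2
    subst h12
    simp only at he
    have e1 := hookLen_eq hm1
    have e2 := hookLen_eq hm2
    rcases le_total j1 j2 with h | h
    · have := γ.colLen_anti _ _ h
      rw [show j1 = j2 by omega]
    · have := γ.colLen_anti _ _ h
      rw [show j1 = j2 by omega]
  · intro n hn
    simp only [Finset.mem_filter, Finset.mem_Icc] at hn
    obtain ⟨j, hj⟩ := exists_colGap hn.2
    have hmem : (i, j) ∈ γ := by
      rw [mem_iff_row]
      have h := lt_rowLen_iff_lt_colLen (γ := γ) (i := i) (j := j)
      by_contra h1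
      have : ¬ i < γ.colLen j := fun h2 => h1 (h.2 h2)
      omega
    have e := hookLen_eq hmem
    refine ⟨(i, j), ?_, ?_⟩
    · simp only [Finset.mem_filter, YoungDiagram.mem_cells]
      exact ⟨hmem, trivial, by omega⟩
    · simp only
      omega

theorem pSize_eq_sum (k : ℕ) (γ : YoungDiagram) {N : ℕ} (hN : γ.colLen 0 ≤ N) :
    pSize k γ = ∑ i ∈ Finset.range N, pRow k γ i := by
  unfold pSize
  rw [Finset.card_eq_sum_card_fiberwise (f := Prod.fst) (t := Finset.range N)]
  · apply Finset.sum_congr rfl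
    intro i _
    unfold pRow
    rw [Finset.filter_filter]
    congr 1
    ext c
    simp only [Finset.mem_filter]
    tauto
  · rintro ⟨i, j⟩ hc
    simp only [Finset.coe_filter, Set.mem_ofPred_eq, YoungDiagram.mem_cells] at hc
    simp only [Finset.coe_range, Set.mem_Iio]
    have h1 := mem_iff_col.1 hc.1
    have h2 := γ.colLen_anti 0 j (Nat.zero_le _)
    omega

theorem pRow_le_pRow_removeRes {k : ℕ} (hk : 1 ≤ k) {γ : YoungDiagram}
    (hc : IsCore (k + 1) γ) {c : ℕ × ℕ} (hrem : Removable γ c) (i : ℕ) :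
    pRow k γ i ≤ pRow k (removeRes k (residue k c) γ) i +
      if ((((γ.rowLen i : ℤ) - i : ℤ) : ZMod (k + 1)) = residue k c + 1 ∧
          ¬ IsBead γ ((γ.rowLen i : ℤ) - i - 1) ∧
          IsBead γ ((γ.rowLen i : ℤ) - i - 1 - ((k + 1 : ℕ) : ℤ))) then 1 else 0 := by
  have hne := add_one_ne_self_zmod hk (residue k c)
  have hsucc := fun {z : ℤ} => hc.bead_succ hrem (z := z)
  have hb : IsBead γ ((γ.rowLen i : ℤ) - i) := ⟨i, rfl⟩
  rw [pRow_eq_card, pRow_eq_card, rowLen_removeRes]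
  generalize (γ.rowLen i : ℤ) - i = b at *
  generalize residue k c = r at *
  -- beads of the smaller core
  have hB : ∀ {z : ℤ}, IsBead (removeRes k r γ) z →
      ((z : ZMod (k + 1)) = r → IsBead γ (z + 1)) ∧
      ((z : ZMod (k + 1)) = r + 1 → IsBead γ (z - 1)) ∧
      ((z : ZMod (k + 1)) ≠ r → (z : ZMod (k + 1)) ≠ r + 1 → IsBead γ z) := by
    intro z hz
    rw [isBead_removeRes] at hz
    refine ⟨fun h => ?_, fun h => ?_, fun h h' => ?_⟩
    · rcases hz with hz | hz
      · exact hsucc hz.1 h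
      · exact hz.1
    · rcases hz with hz | hz
      · by_contra h2
        exact hz.2 ⟨h, h2⟩
      · exact absurd (h.symm.trans hz.2.1) hne
    · rcases hz with hz | hz
      · exact hz.1
      · exact absurd hz.2.1 h
  by_cases hbr1 : (b : ZMod (k + 1)) = r + 1
  · by_cases hb1 : IsBead γ (b - 1)
    · rw [if_neg (fun h => h.2 hb1)]
      refine le_add_right (Finset.card_le_card ?_)
      intro j hj
      simp only [Finset.mem_filter, Finset.mem_Icc] at hj ⊢
      refine ⟨hj.1, fun h => hj.2 ?_⟩
      by_cases e1 : ((b - j : ℤ) : ZMod (k + 1)) = r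
      · refine bead_of_le hc hb1 (by omega) ?_
        rw [e1, Int.cast_sub, hbr1]
        simp
      · by_cases e2 : ((b - j : ℤ) : ZMod (k + 1)) = r + 1
        · exact bead_of_le hc hb (by omega) (e2.trans hbr1.symm)
        · exact (hB h).2.2 e1 e2
    · rw [if_pos ⟨hbr1, hb1⟩]
      have hstep : ∀ j : ℕ, 2 ≤ j → j ≤ k → ¬ IsBead γ (b - j) →
          ¬ IsBead (removeRes k r γ) (b - 1 - (j - 1 : ℕ)) := by
        intro j h2 hjk hg h
        rw [show (b - 1 - (j - 1 : ℕ) : ℤ) = b - j by omega] at h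
        apply hg
        have e1 : ((b - j : ℤ) : ZMod (k + 1)) ≠ r := by
          intro e1
          have e3 : ((b - j : ℤ) : ZMod (k + 1)) = ((b - 1 : ℤ) : ZMod (k + 1)) := by
            rw [e1, Int.cast_sub, hbr1]
            simp
          rw [ZMod.intCast_eq_intCast_iff_dvd_sub] at e3
          have := Int.le_of_dvd (by omega) e3
          push_cast at this
          omega
        by_cases e2 : ((b - j : ℤ) : ZMod (k + 1)) = r + 1
        · exact bead_of_le hc hb (by omega) (e2.trans hbr1.symm)
        · exact (hB h).2.2 e1 e2
      by_cases hsp : IsBead γ (b - 1 - ((k + 1 : ℕ) : ℤ))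
      · rw [if_pos ⟨hbr1, hb1, hsp⟩]
        refine le_trans (b := (insert 1 (((Finset.Icc 1 k).filter
          fun j : ℕ => ¬ IsBead (removeRes k r γ) (b - 1 - j)).image (· + 1))).card)
          (Finset.card_le_card ?_) ((Finset.card_insert_le _ _).trans
            (Nat.add_le_add_right Finset.card_image_le 1))
        intro j hj
        simp only [Finset.mem_filter, Finset.mem_Icc, Finset.mem_insert, Finset.mem_image] at hj ⊢
        by_cases hj1 : j = 1
        · exact Or.inl hj1
        · exact Or.inr ⟨j - 1, ⟨by omega, hstep j (by omega) hj.1.2 hj.2⟩, by omega⟩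
      · refine le_add_right (Finset.card_le_card_of_injOn
          (fun j => if j = 1 then k else j - 1) ?_ ?_)
        · intro j hj
          simp only [Finset.coe_filter, Set.mem_ofPred_eq, Finset.mem_Icc] at hj ⊢
          split_ifs with hj1
          · refine ⟨by omega, fun h => hsp ?_⟩
            have hcast : ((b - 1 - (k : ℕ) : ℤ) : ZMod (k + 1)) = r + 1 := by
              rw [show (b - 1 - (k : ℕ) : ℤ) = b - ((k + 1 : ℕ) : ℤ) by push_cast; ring,
                Int.cast_sub, cast_succ_eq_zero, hbr1, sub_zero]
            have := (hB h).2.1 hcast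
            convert this using 1
            push_cast
            ring
          · exact ⟨by omega, hstep j (by omega) hj.1.2 hj.2⟩
        · intro j hj j' hj'
          simp only [Finset.coe_filter, Set.mem_ofPred_eq, Finset.mem_Icc] at hj hj' ⊢
          split_ifs <;> omega
  · rw [if_neg (fun h => hbr1 h.1)]
    by_cases hbr : (b : ZMod (k + 1)) = r
    · refine le_add_right (Finset.card_le_card ?_)
      intro j hj
      simp only [Finset.mem_filter, Finset.mem_Icc] at hj ⊢
      refine ⟨hj.1, fun h => hj.2 ?_⟩
      by_cases e1 : ((b - j : ℤ) : ZMod (k + 1)) = r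
      · exact bead_of_le hc hb (by omega) (e1.trans hbr.symm)
      · by_cases e2 : ((b - j : ℤ) : ZMod (k + 1)) = r + 1
        · refine bead_of_le hc (hsucc hb hbr) (by omega) ?_
          rw [e2, Int.cast_add, hbr]
          simp
        · exact (hB h).2.2 e1 e2
    · refine le_add_right (Finset.card_le_card_of_injOn
        (fun j => if ((b - j : ℤ) : ZMod (k + 1)) = r then j - 1
          else if ((b - j : ℤ) : ZMod (k + 1)) = r + 1 then j + 1 else j) ?_ ?_)
      · intro j hj
        simp only [Finset.coe_filter, Set.mem_ofPred_eq, Finset.mem_Icc] at hj ⊢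
        split_ifs with e1 e2
        · have hj1 : j ≠ 1 := by
            rintro rfl
            apply hbr1
            rw [← e1]
            simp
          have e3 : (b - (j - 1 : ℕ) : ℤ) = b - j + 1 := by omega
          refine ⟨by omega, fun h => hj.2 ?_⟩
          rw [e3] at h
          have := (hB h).2.1 (by rw [Int.cast_add, e1]; simp)
          simpa using this
        · have hjk : j ≠ k := by
            rintro rfl
            apply hbr
            have h0 := cast_succ_eq_zero j
            push_cast at e2 h0
            linear_combination e2 + h0
          refine ⟨by omega, fun h => hj.2 ?_⟩
          have e3 : (b - (j + 1 : ℕ) : ℤ) = b - j - 1 := by push_cast; ring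
          rw [e3] at h
          have := (hB h).1 (by rw [Int.cast_sub, e2]; simp)
          simpa using this
        · exact ⟨hj.1, fun h => hj.2 ((hB h).2.2 e1 e2)⟩
      · have hiff : ∀ j : ℕ, ((b - (j + 1 : ℕ) : ℤ) : ZMod (k + 1)) = r ↔
            ((b - j : ℤ) : ZMod (k + 1)) = r + 1 := by
          intro j
          rw [show (b - j : ℤ) = (b - (j + 1 : ℕ)) + 1 by push_cast; ring, Int.cast_add,
            Int.cast_one, add_left_inj]
        have key : ∀ j j' : ℕ, 1 ≤ j → 1 ≤ j' →
            (if ((b - j : ℤ) : ZMod (k + 1)) = r then j - 1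
              else if ((b - j : ℤ) : ZMod (k + 1)) = r + 1 then j + 1 else j) =
            (if ((b - j' : ℤ) : ZMod (k + 1)) = r then j' - 1
              else if ((b - j' : ℤ) : ZMod (k + 1)) = r + 1 then j' + 1 else j') → j ≤ j' := by
          intro j j' h1 h1' he
          by_contra! hlt
          obtain rfl | rfl | hgt : j = j' + 1 ∨ j = j' + 1 + 1 ∨ j' + 2 < j := by omega
          · have := hiff j'
            split_ifs at he <;> first | omega | tauto
          · have e1 := hiff j'
            have e2 := hiff (j' + 1)
            split_ifs at he with a1 a2 a3 a4 a5 a6 a7 a8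
            all_goals first | omega | exact hne ((e2.1 a1).symm.trans (e1.2 a3))
          · split_ifs at he <;> omega
        intro j hj j' hj' he
        simp only [Finset.coe_filter, Set.mem_ofPred_eq, Finset.mem_Icc] at hj hj'
        exact le_antisymm (key j j' hj.1.1 hj'.1.1 he) (key j' j hj'.1.1 hj.1.1 he.symm)

theorem pSize_le_pSize_removeRes {k : ℕ} (hk : 1 ≤ k) (r : ZMod (k + 1)) {γ : YoungDiagram}
    (hc : IsCore (k + 1) γ) : pSize k γ ≤ pSize k (removeRes k r γ) + 1 := by
  by_cases hex : ∃ c, Removable γ c ∧ residue k c = r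
  · obtain ⟨c, hrem, rfl⟩ := hex
    have hcol : (removeRes k (residue k c) γ).colLen 0 ≤ γ.colLen 0 := by
      by_contra! hlt
      exact lt_irrefl _ (mem_iff_col.1 (mem_removeRes.1 (mem_iff_col.2 hlt)).1)
    rw [pSize_eq_sum k γ le_rfl, pSize_eq_sum k _ hcol]
    refine (Finset.sum_le_sum fun i _ => pRow_le_pRow_removeRes hk hc hrem i).trans ?_
    rw [Finset.sum_add_distrib, ← Finset.card_filter]
    refine Nat.add_le_add_left (Finset.card_le_one.2 ?_) _
    have key : ∀ {i i' : ℕ}, i < i' →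
        (((γ.rowLen i : ℤ) - i : ℤ) : ZMod (k + 1)) = residue k c + 1 →
        (((γ.rowLen i' : ℤ) - i' : ℤ) : ZMod (k + 1)) = residue k c + 1 →
        ¬ IsBead γ ((γ.rowLen i' : ℤ) - i' - 1) →
        ¬ IsBead γ ((γ.rowLen i : ℤ) - i - 1 - ((k + 1 : ℕ) : ℤ)) := by
      intro i i' hlt h1 h2 h3 h4
      have hlt' := bead_strictAnti γ hlt
      obtain ⟨t, ht⟩ := (ZMod.intCast_eq_intCast_iff_dvd_sub _ _ _).1 (h2.trans h1.symm)
      refine h3 (bead_of_le hc h4 ?_ ?_)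
      · have : 1 ≤ t := by
          by_contra! h
          have : ((k + 1 : ℕ) : ℤ) * t ≤ 0 :=
            mul_nonpos_of_nonneg_of_nonpos (by positivity) (by omega)
          omega
        have : ((k + 1 : ℕ) : ℤ) * 1 ≤ ((k + 1 : ℕ) : ℤ) * t :=
          mul_le_mul_of_nonneg_left this (by positivity)
        omega
      · rw [Int.cast_sub, h2, Int.cast_sub, Int.cast_sub, h1, cast_succ_eq_zero, sub_zero]
    intro i hi i' hi'
    simp only [Finset.mem_filter] at hi hi'
    rcases lt_trichotomy i i' with h | h | h
    · exact absurd hi.2.2.2 (key h hi.2.1 hi'.2.1 hi'.2.2.1)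
    · exact h
    · exact absurd hi'.2.2.2 (key h hi'.2.1 hi.2.1 hi.2.2.1)
  · have : removeRes k r γ = γ := by
      ext c
      simp only [YoungDiagram.mem_cells, mem_removeRes]
      exact ⟨fun h => h.1, fun h => ⟨h, fun h' => hex ⟨c, h'⟩⟩⟩
    rw [this]
    exact Nat.le_succ _

/-! ## Existence of the core of a `k`-bounded partition -/

/-- The diagram obtained from `γ` by inserting a first row of length `L`. -/
def prependRow (γ : YoungDiagram) (L : ℕ) (hL : γ.rowLen 0 ≤ L) : YoungDiagram where
  cells := (Finset.range L).image (fun j => (0, j)) ∪ γ.cells.image (fun c => (c.1 + 1, c.2))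
  isLowerSet := by
    rintro ⟨a1, a2⟩ ⟨b1, b2⟩ hba ha
    obtain ⟨h1, h2⟩ := Prod.mk_le_mk.1 hba
    simp only [Finset.coe_union, Finset.coe_image, Set.mem_union, Set.mem_image, Finset.mem_coe,
      Finset.mem_range, YoungDiagram.mem_cells, Prod.mk.injEq, Prod.exists] at ha ⊢
    have hlen : ∀ i j, (i, j) ∈ γ → j < L := fun i j h => by
      have := mem_iff_row.1 h
      have := γ.rowLen_anti 0 i (Nat.zero_le _)
      omega
    rcases Nat.eq_zero_or_pos b1 with rfl | hb1
    · refine Or.inl ⟨b2, ?_, rfl, rfl⟩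
      rcases ha with ⟨j, hj, -, rfl⟩ | ⟨i, j, hij, -, rfl⟩
      · omega
      · exact lt_of_le_of_lt h2 (hlen _ _ hij)
    · rcases ha with ⟨j, hj, h0, -⟩ | ⟨i, j, hij, rfl, rfl⟩
      · omega
      · exact Or.inr ⟨b1 - 1, b2, γ.up_left_mem (by omega) h2 hij, by omega, rfl⟩

section PrependRow

variable {γ : YoungDiagram} {L : ℕ} {hL : γ.rowLen 0 ≤ L}

theorem mem_prependRow_zero {j : ℕ} : (0, j) ∈ prependRow γ L hL ↔ j < L := by
  rw [← YoungDiagram.mem_cells]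
  simp [prependRow]

theorem mem_prependRow_succ {i j : ℕ} : (i + 1, j) ∈ prependRow γ L hL ↔ (i, j) ∈ γ := by
  rw [← YoungDiagram.mem_cells]
  simp [prependRow]

theorem rowLen_prependRow_zero : (prependRow γ L hL).rowLen 0 = L :=
  rowLen_eq_of_forall fun _ => mem_prependRow_zero

theorem rowLen_prependRow_succ (i : ℕ) : (prependRow γ L hL).rowLen (i + 1) = γ.rowLen i :=
  rowLen_eq_of_forall fun _ => mem_prependRow_succ.trans mem_iff_row

theorem colLen_prependRow {j : ℕ} (hj : j < L) :
    (prependRow γ L hL).colLen j = γ.colLen j + 1 := by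
  have h : ∀ i, i + 1 < (prependRow γ L hL).colLen j ↔ i < γ.colLen j := fun i => by
    rw [← mem_iff_col, mem_prependRow_succ, mem_iff_col]
  have h0 : 0 < (prependRow γ L hL).colLen j := by
    rw [← mem_iff_col, mem_prependRow_zero]
    exact hj
  have h1 := h (γ.colLen j)
  have h2 := h (γ.colLen j - 1)
  omega

theorem hookLen_prependRow_succ {i j : ℕ} (h : (i, j) ∈ γ) :
    hookLen (prependRow γ L hL) (i + 1) j = hookLen γ i j := by
  have hj : j < L := by
    have := mem_iff_row.1 h
    have := γ.rowLen_anti 0 i (Nat.zero_le _)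
    omega
  have := mem_iff_row.1 h
  have := mem_iff_col.1 h
  unfold hookLen
  rw [rowLen_prependRow_succ, colLen_prependRow hj]
  omega

theorem hookLen_prependRow_zero {j : ℕ} (hj : j < L) :
    hookLen (prependRow γ L hL) 0 j = L - j + γ.colLen j := by
  unfold hookLen
  rw [rowLen_prependRow_zero, colLen_prependRow hj]
  omega

theorem pRow_prependRow_succ (k i : ℕ) : pRow k (prependRow γ L hL) (i + 1) = pRow k γ i := by
  unfold pRow
  symm
  apply Finset.card_bij (fun c _ => (c.1 + 1, c.2))
  · rintro ⟨i', j⟩ h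
    simp only [Finset.mem_filter, YoungDiagram.mem_cells] at h ⊢
    obtain ⟨h1, rfl, h2⟩ := h
    exact ⟨mem_prependRow_succ.2 h1, rfl, by rwa [hookLen_prependRow_succ h1]⟩
  · rintro ⟨i1, j1⟩ _ ⟨i2, j2⟩ _ h
    simpa using h
  · rintro ⟨i', j⟩ h
    simp only [Finset.mem_filter, YoungDiagram.mem_cells] at h
    obtain ⟨h1, rfl, h2⟩ := h
    have h3 := mem_prependRow_succ.1 h1
    refine ⟨(i, j), ?_, rfl⟩
    simp only [Finset.mem_filter, YoungDiagram.mem_cells]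
    exact ⟨h3, trivial, by rwa [hookLen_prependRow_succ h3] at h2⟩

theorem pRow_prependRow_zero (k : ℕ) : pRow k (prependRow γ L hL) 0 =
    ((Finset.range L).filter fun j => L - j + γ.colLen j ≤ k).card := by
  unfold pRow
  symm
  apply Finset.card_bij (fun j _ => (0, j))
  · intro j h
    simp only [Finset.mem_filter, Finset.mem_range, YoungDiagram.mem_cells] at h ⊢
    exact ⟨mem_prependRow_zero.2 h.1, trivial, by rw [hookLen_prependRow_zero h.1]; exact h.2⟩
  · intro j1 _ j2 _ h
    simpa using h
  · rintro ⟨i', j⟩ h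
    simp only [Finset.mem_filter, YoungDiagram.mem_cells] at h
    obtain ⟨h1, rfl, h2⟩ := h
    have h3 := mem_prependRow_zero.1 h1
    refine ⟨j, ?_, rfl⟩
    simp only [Finset.mem_filter, Finset.mem_range]
    exact ⟨h3, by rwa [hookLen_prependRow_zero h3] at h2⟩

theorem isCore_prependRow {p : ℕ} (hc : IsCore p γ)
    (h : ∀ j < L, L - j + γ.colLen j ≠ p) : IsCore p (prependRow γ L hL) := by
  rintro ⟨i, j⟩ hij
  simp only
  cases i with
  | zero =>
    have := mem_prependRow_zero.1 hij
    rw [hookLen_prependRow_zero this]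
    exact h j this
  | succ i =>
    have := mem_prependRow_succ.1 hij
    rw [hookLen_prependRow_succ this]
    exact hc _ this

end PrependRow

theorem exists_rowLen_prepend {k : ℕ} (γ : YoungDiagram) {m : ℕ} (hmk : m ≤ k)
    (hm : pRow k γ 0 ≤ m) :
    ∃ L, γ.rowLen 0 ≤ L ∧
      ((Finset.range L).filter fun j => L - j + γ.colLen j ≤ k).card = m ∧
      ∀ j < L, L - j + γ.colLen j ≠ k + 1 := by
  set f : ℕ → Finset ℕ := fun L => (Finset.range L).filter fun j => L - j + γ.colLen j ≤ k
    with hf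
  have hmem : ∀ {L j}, j ∈ f L ↔ j < L ∧ L - j + γ.colLen j ≤ k := by
    intro L j
    simp [hf]
  have hex : ∃ L, γ.rowLen 0 ≤ L ∧ m ≤ (f L).card := by
    refine ⟨γ.rowLen 0 + k, by omega, hmk.trans ?_⟩
    have hsub : Finset.Ico (γ.rowLen 0) (γ.rowLen 0 + k) ⊆ f (γ.rowLen 0 + k) := by
      intro j hj
      rw [Finset.mem_Ico] at hj
      rw [hmem]
      have : ¬ 0 < γ.colLen j := fun h => by
        have := lt_rowLen_iff_lt_colLen.2 h
        omega
      omega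
    have := Finset.card_le_card hsub
    simpa using this
  have hspec := Nat.find_spec hex
  have hmin : ∀ L < Nat.find hex, ¬ (γ.rowLen 0 ≤ L ∧ m ≤ (f L).card) :=
    fun L hL => Nat.find_min hex hL
  set L := Nat.find hex with hL
  refine ⟨L, hspec.1, ?_⟩
  change (f L).card = m ∧ _
  rcases hspec.1.eq_or_lt with heq | hlt
  · have hrow : pRow k γ 0 = ((Finset.range L).filter
        fun j => L - j + γ.colLen j ≤ k + 1).card := by
      unfold pRow
      symm
      apply Finset.card_bij (fun j _ => (0, j))
      · intro j h
        simp only [Finset.mem_filter, Finset.mem_range, YoungDiagram.mem_cells] at h ⊢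
        refine ⟨mem_iff_row.2 (by omega), trivial, ?_⟩
        unfold hookLen
        omega
      · intro j1 _ j2 _ h
        simpa using h
      · rintro ⟨i', j⟩ h
        simp only [Finset.mem_filter, YoungDiagram.mem_cells] at h
        obtain ⟨h1, rfl, h2⟩ := h
        have h3 := mem_iff_row.1 h1
        refine ⟨j, ?_, rfl⟩
        simp only [Finset.mem_filter, Finset.mem_range]
        unfold hookLen at h2
        omega
    have hsub : f L ⊆ (Finset.range L).filter fun j => L - j + γ.colLen j ≤ k + 1 := by
      intro j hj
      rw [hmem] at hj
      simp only [Finset.mem_filter, Finset.mem_range]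
      omega
    have hle := Finset.card_le_card hsub
    have heqs := Finset.eq_of_subset_of_card_le hsub (by omega)
    refine ⟨by omega, fun j hj he => ?_⟩
    have : j ∈ f L := by
      rw [heqs]
      simp only [Finset.mem_filter, Finset.mem_range]
      omega
    rw [hmem] at this
    omega
  · have h1 : (f (L - 1)).card < m := by
      have := hmin (L - 1) (by omega)
      omega
    have hsub : f L ⊆ insert (L - 1) (f (L - 1)) := by
      intro j hj
      rw [hmem] at hj
      rw [Finset.mem_insert, hmem]
      omega
    have h2 : (f L).card ≤ (f (L - 1)).card + 1 :=
      (Finset.card_le_card hsub).trans (Finset.card_insert_le _ _)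
    refine ⟨by omega, fun j hj he => ?_⟩
    by_cases hjL : j = L - 1
    · have h0 : ¬ 0 < γ.colLen j ∨ L - 1 < γ.rowLen 0 := by
        by_contra! h
        have := lt_rowLen_iff_lt_colLen.2 h.1
        omega
      have h3 : γ.colLen j = 0 := by omega
      have hk0 : k = 0 := by omega
      omega
    · have hsub' : f L ⊆ insert (L - 1) ((f (L - 1)).erase j) := by
        intro i hi
        have hi' := hi
        rw [hmem] at hi
        rw [Finset.mem_insert, Finset.mem_erase, hmem]
        by_cases hij : i = j
        · subst hij
          omega
        · omega
      have hj' : j ∈ f (L - 1) := by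
        rw [hmem]
        omega
      have h3 := (Finset.card_le_card hsub').trans (Finset.card_insert_le _ _)
      rw [Finset.card_erase_of_mem hj'] at h3
      have := Finset.card_pos.2 ⟨j, hj'⟩
      omega

theorem exists_core_of_pRow {k : ℕ} (n : ℕ) : ∀ f : ℕ → ℕ, Antitone f → (∀ i, f i ≤ k) →
    f n = 0 → ∃ γ, IsCore (k + 1) γ ∧ ∀ i, pRow k γ i = f i := by
  induction n with
  | zero =>
    intro f hf _ h0
    refine ⟨⊥, fun c hc => absurd hc (YoungDiagram.notMem_bot c), fun i => ?_⟩
    have := hf (Nat.zero_le i)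
    rw [show f i = 0 by omega]
    simp [pRow]
  | succ n ih =>
    intro f hf hk h0
    obtain ⟨γ, hc, hrow⟩ := ih (fun i => f (i + 1)) (fun a b hab => hf (by omega))
      (fun i => hk _) h0
    obtain ⟨L, hL, hcard, hhook⟩ := exists_rowLen_prepend γ (hk 0)
      (by rw [hrow]; exact hf (Nat.zero_le _))
    refine ⟨prependRow γ L hL, isCore_prependRow hc hhook, fun i => ?_⟩
    cases i with
    | zero => rw [pRow_prependRow_zero, hcard]
    | succ i => rw [pRow_prependRow_succ, hrow]

theorem coreOf_spec {k : ℕ} {lam : YoungDiagram} (hlam : IsKBounded k lam) :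
    IsCore (k + 1) (coreOf k lam) ∧ ∀ i, pRow k (coreOf k lam) i = lam.rowLen i := by
  refine Classical.epsilon_spec
    (p := fun γ => IsCore (k + 1) γ ∧ ∀ i, pRow k γ i = lam.rowLen i) ?_
  refine exists_core_of_pRow (lam.colLen 0) lam.rowLen
    (fun a b hab => lam.rowLen_anti a b hab) hlam ?_
  by_contra h
  exact lt_irrefl _ (lt_rowLen_iff_lt_colLen.1 (Nat.pos_of_ne_zero h))

theorem pSize_coreOf {k : ℕ} {lam : YoungDiagram} (hlam : IsKBounded k lam) :
    pSize k (coreOf k lam) = lam.card := by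
  set N := max ((coreOf k lam).colLen 0) (lam.colLen 0) with hN
  rw [pSize_eq_sum k _ (le_max_left _ _ : _ ≤ N)]
  simp_rw [(coreOf_spec hlam).2, YoungDiagram.rowLen_eq_card]
  symm
  apply Finset.card_eq_sum_card_fiberwise (f := Prod.fst)
  rintro ⟨i, j⟩ hc
  have h1 := mem_iff_col.1 (show (i, j) ∈ lam from hc)
  have h2 := lam.colLen_anti 0 j (Nat.zero_le _)
  have h3 := le_max_right ((coreOf k lam).colLen 0) (lam.colLen 0)
  simp only [Finset.coe_range, Set.mem_Iio]
  omega

/-! ## Standard fillings of cores -/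

/-- A strictly increasing filling of `γ` by letters in `{1, …, n}`, all occurrences of the letter
`y` having residue `ρ y`. -/
structure IsStdFilling (k n : ℕ) (γ : YoungDiagram) (v : ℕ × ℕ → ℕ) (ρ : ℕ → ZMod (k + 1)) :
    Prop where
  pos : ∀ c ∈ γ, 1 ≤ v c
  le : ∀ c ∈ γ, v c ≤ n
  up : ∀ r c, (r + 1, c) ∈ γ → v (r, c) < v (r + 1, c)
  right : ∀ r c, (r, c + 1) ∈ γ → v (r, c) < v (r, c + 1)
  res : ∀ c ∈ γ, residue k c = ρ (v c)

theorem mono_of_steps {γ : YoungDiagram} {v : ℕ × ℕ → ℕ}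
    (up : ∀ r c, (r + 1, c) ∈ γ → v (r, c) < v (r + 1, c))
    (right : ∀ r c, (r, c + 1) ∈ γ → v (r, c) ≤ v (r, c + 1))
    {i j i' j' : ℕ} (h : (i', j') ∈ γ) (hi : i ≤ i') (hj : j ≤ j') :
    v (i, j) + (i' - i) ≤ v (i', j') := by
  have h1 : v (i, j) ≤ v (i, j') := by
    induction j', hj using Nat.le_induction with
    | base => exact le_rfl
    | succ m hm ih =>
      exact (ih (γ.up_left_mem le_rfl (Nat.le_succ m) h)).trans
        (right i m (γ.up_left_mem hi le_rfl h))
  refine (Nat.add_le_add_right h1 _).trans ?_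
  induction i', hi using Nat.le_induction with
  | base => simp
  | succ m hm ih =>
    have h2 := ih (γ.up_left_mem (Nat.le_succ m) le_rfl h)
    have h3 := up m j' h
    omega

theorem IsStdFilling.lt_of_le {k n : ℕ} {γ : YoungDiagram} {v : ℕ × ℕ → ℕ}
    {ρ : ℕ → ZMod (k + 1)} (hv : IsStdFilling k n γ v ρ) {c d : ℕ × ℕ} (hc : c ∈ γ)
    (hdc : d ≤ c) (hne : d ≠ c) : v d < v c := by
  obtain ⟨i, j⟩ := c
  obtain ⟨i', j'⟩ := d
  obtain ⟨h1, h2⟩ := Prod.mk_le_mk.1 hdc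
  rcases h1.eq_or_lt with rfl | h1
  · have h3 : j' < j := lt_of_le_of_ne h2 (fun h => hne (by rw [h]))
    have h4 := mono_of_steps hv.up (fun r c h => (hv.right r c h).le)
      (i := i') (j := j') (i' := i') (j' := j - 1) (γ.up_left_mem le_rfl (by omega) hc)
      le_rfl (by omega)
    have h5 := hv.right i' (j - 1) (by rwa [Nat.sub_add_cancel (by omega)])
    rw [Nat.sub_add_cancel (by omega)] at h5
    omega
  · have := mono_of_steps hv.up (fun r c h => (hv.right r c h).le) hc h1.le h2
    omega

theorem IsStdFilling.removeRes_last {k n : ℕ} {γ : YoungDiagram} {v : ℕ × ℕ → ℕ}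
    {ρ : ℕ → ZMod (k + 1)} (hv : IsStdFilling k (n + 1) γ v ρ) :
    IsStdFilling k n (removeRes k (ρ (n + 1)) γ) v ρ where
  pos c hc := hv.pos c (mem_removeRes.1 hc).1
  le c hc := by
    rw [mem_removeRes] at hc
    have h1 := hv.le c hc.1
    by_contra! h2
    have h3 : v c = n + 1 := by omega
    refine hc.2 ⟨⟨hc.1, fun h => ?_, fun h => ?_⟩, by rw [hv.res c hc.1, h3]⟩
    · have := hv.up _ _ h
      have := hv.le _ h
      simp only [Prod.mk.eta] at *
      omega
    · have := hv.right _ _ h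
      have := hv.le _ h
      simp only [Prod.mk.eta] at *
      omega
  up r c h := hv.up r c (mem_removeRes.1 h).1
  right r c h := hv.right r c (mem_removeRes.1 h).1
  res c hc := hv.res c (mem_removeRes.1 hc).1

theorem IsStdFilling.pSize_le {k : ℕ} (hk : 1 ≤ k) {n : ℕ} {γ : YoungDiagram} {v : ℕ × ℕ → ℕ}
    {ρ : ℕ → ZMod (k + 1)} (hc : IsCore (k + 1) γ) (hv : IsStdFilling k n γ v ρ) :
    pSize k γ ≤ n := by
  induction n generalizing γ with
  | zero =>
    rw [Nat.le_zero]
    unfold pSize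
    rw [Finset.card_eq_zero, Finset.filter_eq_empty_iff]
    intro c h
    rw [YoungDiagram.mem_cells] at h
    have := hv.pos c h
    have := hv.le c h
    omega
  | succ n ih =>
    have h1 := ih (isCore_removeRes hk _ hc) hv.removeRes_last
    have h2 := pSize_le_pSize_removeRes hk (ρ (n + 1)) hc
    omega

/-- In a standard filling of a core with the least possible number of letters, all the shapes
`T_{≤ y}` are cores, and `y` occupies all removable corners of its residue. -/
theorem IsStdFilling.exists_core {k : ℕ} (hk : 1 ≤ k) {n : ℕ} {γ : YoungDiagram}
    {v : ℕ × ℕ → ℕ} {ρ : ℕ → ZMod (k + 1)} (hc : IsCore (k + 1) γ)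
    (hv : IsStdFilling k n γ v ρ) (hsize : pSize k γ = n) {y : ℕ} (hy : 1 ≤ y) (hyn : y ≤ n) :
    ∃ δ : YoungDiagram, IsCore (k + 1) δ ∧ (∀ c, c ∈ δ ↔ c ∈ γ ∧ v c ≤ y) ∧
      (∃ c ∈ γ, v c = y) ∧ ∀ c, (c ∈ γ ∧ v c = y) ↔ (Removable δ c ∧ residue k c = ρ y) := by
  induction n generalizing γ y with
  | zero => omega
  | succ n ih =>
    have hc' := isCore_removeRes hk (ρ (n + 1)) hc
    have hv' := hv.removeRes_last
    have h1 := hv'.pSize_le hk hc'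
    have h2 := pSize_le_pSize_removeRes hk (ρ (n + 1)) hc
    have hsize' : pSize k (removeRes k (ρ (n + 1)) γ) = n := by omega
    have IH := fun {y : ℕ} => ih hc' hv' hsize' (y := y)
    have hsub : ∀ m : ℕ, m ≤ n → ∀ c ∈ γ, v c = m → c ∈ removeRes k (ρ (n + 1)) γ := by
      intro m
      induction m using Nat.strong_induction_on with
      | _ m ihm =>
        intro hm c hcγ hcm
        obtain ⟨δ, hδ, hmem, ⟨c₀, hc₀, hc₀m⟩, hrem⟩ := IH (hcm ▸ hv.pos c hcγ) hm
        by_contra hnot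
        have hadd : Addable δ c := by
          refine ⟨fun h => hnot ((hmem c).1 h).1, fun d hd hne => ?_⟩
          have hlt := hv.lt_of_le hcγ hd hne
          have hdγ : d ∈ γ := γ.isLowerSet hd hcγ
          exact (hmem d).2 ⟨ihm (v d) (by omega) (by omega) d hdγ rfl, by omega⟩
        obtain ⟨hr, hres⟩ := (hrem c₀).1 ⟨hc₀, hc₀m⟩
        refine hδ.not_removable_addable hr hadd ?_
        rw [hres, hv.res c hcγ, hcm]
    have hiff : ∀ c, c ∈ removeRes k (ρ (n + 1)) γ ↔ c ∈ γ ∧ v c ≤ n :=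
      fun c => ⟨fun h => ⟨(mem_removeRes.1 h).1, hv'.le c h⟩, fun h => hsub _ h.2 c h.1 rfl⟩
    rcases hyn.eq_or_lt with rfl | hlt
    · have hlast : ∀ c, (c ∈ γ ∧ v c = n + 1) ↔
          (Removable γ c ∧ residue k c = ρ (n + 1)) := by
        intro c
        constructor
        · rintro ⟨hcγ, hcv⟩
          by_contra h
          have := hv'.le c (mem_removeRes.2 ⟨hcγ, h⟩)
          omega
        · intro h
          refine ⟨h.1.1, ?_⟩
          have h3 := hv.le c h.1.1
          by_contra hne
          exact (mem_removeRes.1 ((hiff c).2 ⟨h.1.1, by omega⟩)).2 h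
      refine ⟨γ, hc, fun c => ⟨fun h => ⟨h, hv.le c h⟩, fun h => h.1⟩, ?_, hlast⟩
      by_contra! hno
      have : removeRes k (ρ (n + 1)) γ = γ := by
        ext c
        simp only [YoungDiagram.mem_cells, hiff]
        refine ⟨fun h => h.1, fun h => ⟨h, ?_⟩⟩
        have := hv.le c h
        have := hno c h
        omega
      rw [this] at hsize'
      omega
    · obtain ⟨δ, hδ, hmem, ⟨c₀, hc₀, hc₀m⟩, hrem⟩ := IH hy (by omega)
      refine ⟨δ, hδ, fun c => ?_, ⟨c₀, ((hiff _).1 hc₀).1, hc₀m⟩, fun c => ?_⟩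
      · rw [hmem, hiff]
        constructor
        · rintro ⟨⟨h1, -⟩, h2⟩
          exact ⟨h1, h2⟩
        · rintro ⟨h1, h2⟩
          exact ⟨⟨h1, by omega⟩, h2⟩
      · rw [← hrem, hiff]
        constructor
        · rintro ⟨h1, h2⟩
          exact ⟨⟨h1, by omega⟩, h2⟩
        · rintro ⟨⟨h1, -⟩, h2⟩
          exact ⟨h1, h2⟩

/-! ## Horizontal strips in cores -/

/-- `u` is weakly increasing along rows and strictly increasing up columns of `γ`. -/
structure IsSemistd (γ : YoungDiagram) (u : ℕ × ℕ → ℕ) : Prop where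
  up : ∀ r c, (r + 1, c) ∈ γ → u (r, c) < u (r + 1, c)
  right : ∀ r c, (r, c + 1) ∈ γ → u (r, c) ≤ u (r, c + 1)

theorem IsSemistd.row_le {γ : YoungDiagram} {u : ℕ × ℕ → ℕ} (hu : IsSemistd γ u) {c d : ℕ × ℕ}
    (hd : d ∈ γ) (he : u c = u d) (hle : c.2 ≤ d.2) : d.1 ≤ c.1 := by
  by_contra! hlt
  have := mono_of_steps hu.up hu.right (i := c.1) (j := c.2) (i' := d.1) (j' := d.2) hd hlt.le hle
  simp only [Prod.mk.eta] at this
  omega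

theorem IsSemistd.eq_of_col {γ : YoungDiagram} {u : ℕ × ℕ → ℕ} (hu : IsSemistd γ u)
    {c d : ℕ × ℕ} (hc : c ∈ γ) (hd : d ∈ γ) (he : u c = u d) (hcol : c.2 = d.2) : c = d :=
  Prod.ext (le_antisymm (hu.row_le hc he.symm hcol.ge) (hu.row_le hd he hcol.le)) hcol

/-- The cells of `γ` with label `x` and residue `r`. -/
noncomputable def labelCells (k : ℕ) (γ : YoungDiagram) (u : ℕ × ℕ → ℕ) (x : ℕ)
    (r : ZMod (k + 1)) : Finset (ℕ × ℕ) :=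
  γ.cells.filter fun c => u c = x ∧ residue k c = r

theorem mem_labelCells {k : ℕ} {γ : YoungDiagram} {u : ℕ × ℕ → ℕ} {x : ℕ} {r : ZMod (k + 1)}
    {c : ℕ × ℕ} : c ∈ labelCells k γ u x r ↔ c ∈ γ ∧ u c = x ∧ residue k c = r := by
  simp [labelCells]

/-- The column of the lowest cell with label `x` and residue `r`. -/
noncomputable def lowCol (k : ℕ) (γ : YoungDiagram) (u : ℕ × ℕ → ℕ) (x : ℕ)
    (r : ZMod (k + 1)) : ℕ :=
  (labelCells k γ u x r).sup Prod.snd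

theorem le_lowCol {k : ℕ} {γ : YoungDiagram} {u : ℕ × ℕ → ℕ} {c : ℕ × ℕ} (hc : c ∈ γ) :
    c.2 ≤ lowCol k γ u (u c) (residue k c) :=
  Finset.le_sup (f := Prod.snd) (mem_labelCells.2 ⟨hc, rfl, rfl⟩)

theorem exists_lowCol {k : ℕ} {γ : YoungDiagram} {u : ℕ × ℕ → ℕ} {c : ℕ × ℕ} (hc : c ∈ γ) :
    ∃ d ∈ γ, u d = u c ∧ residue k d = residue k c ∧
      d.2 = lowCol k γ u (u c) (residue k c) := by
  obtain ⟨d, hd, he⟩ := Finset.exists_mem_eq_sup (labelCells k γ u (u c) (residue k c))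
    ⟨c, mem_labelCells.2 ⟨hc, rfl, rfl⟩⟩ Prod.snd
  obtain ⟨h1, h2, h3⟩ := mem_labelCells.1 hd
  exact ⟨d, h1, h2, h3, he.symm⟩

theorem lowCol_lt_of_adjacent {k : ℕ} (hk : 1 ≤ k) {γ δ : YoungDiagram} {u : ℕ × ℕ → ℕ}
    (hu : IsSemistd γ u) {i j : ℕ} (hmem : (i, j + 1) ∈ γ) (heq : u (i, j) = u (i, j + 1))
    (hδ : IsCore (k + 1) δ) (hδu : ∀ c, c ∈ δ ↔ c ∈ γ ∧ u c ≤ u (i, j)) :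
    lowCol k γ u (u (i, j)) (residue k (i, j)) <
      lowCol k γ u (u (i, j)) (residue k (i, j + 1)) := by
  have hres : residue k (i, j + 1) = residue k (i, j) + 1 := by
    simp only [residue]
    push_cast
    ring
  have hmem' : (i, j) ∈ γ := γ.up_left_mem le_rfl (Nat.le_succ j) hmem
  obtain ⟨y, hy, huy, hry, hcy⟩ := exists_lowCol (k := k) (u := u) hmem'
  obtain ⟨x, hx, hux, hrx, hcx⟩ := exists_lowCol (k := k) (u := u) hmem
  rw [← heq] at hcx hux
  rw [← hcy, ← hcx]
  by_contra! hle
  have hne : x.2 ≠ y.2 := fun h => by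
    have := hu.eq_of_col hx hy (hux.trans huy.symm) h
    rw [this, hry, hres] at hrx
    exact add_one_ne_self_zmod hk _ hrx.symm
  have hrow := hu.row_le (c := x) (d := y) hy (hux.trans huy.symm) hle
  have htop : ∀ {z : ℕ × ℕ}, u z = u (i, j) → (z.1 + 1, z.2) ∉ δ := fun {z} hz h => by
    have h1 := hδu _ |>.1 h
    have h2 := hu.up _ _ h1.1
    simp only [Prod.mk.eta] at h2
    omega
  have hyrem : Removable δ y := by
    refine ⟨(hδu y).2 ⟨hy, huy.le⟩, htop huy, fun h => ?_⟩
    have h1 := (hδu _).1 h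
    have h2 := hu.right _ _ h1.1
    simp only [Prod.mk.eta] at h2
    have h3 : u (y.1, y.2 + 1) = u (i, j) := by omega
    have h4 := le_lowCol (k := k) (u := u) h1.1
    have h5 : residue k (y.1, y.2 + 1) = residue k (i, j + 1) := by
      rw [hres, ← hry]
      simp only [residue]
      push_cast
      ring
    rw [h3, h5, ← hcx] at h4
    simp only at h4
    omega
  have hbead : IsBead δ ((x.2 : ℤ) - x.1) := by
    refine bead_of_le hδ hyrem.isBead (by omega) ?_
    rw [Int.cast_add, ← residue_eq, ← residue_eq, hrx, hry, hres]
    simp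
  obtain ⟨i', hi'⟩ := hbead
  have hxlen : x.2 < δ.rowLen x.1 := mem_iff_row.1 ((hδu x).2 ⟨hx, hux.le⟩)
  have hlt : x.1 < i' := by
    by_contra! h
    rcases h.eq_or_lt with rfl | h
    · omega
    · have := bead_strictAnti δ h
      omega
  refine htop hux (δ.up_left_mem hlt le_rfl (mem_iff_row.2 ?_ : (i', x.2) ∈ δ))
  omega

/-! ## Blocks of letters -/

theorem take_sum_succ (α : List ℕ) (x : ℕ) :
    (α.take (x + 1)).sum = (α.take x).sum + α.getD x 0 := by
  rw [List.take_add_one, List.sum_append, List.getD_eq_getElem?_getD]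
  cases α[x]? <;> simp

theorem take_sum_mono (α : List ℕ) : Monotone fun x => (α.take x).sum :=
  monotone_nat_of_le_succ fun x => by
    simp only [take_sum_succ]
    exact Nat.le_add_right _ _

theorem take_sum_le (α : List ℕ) (x : ℕ) : (α.take x).sum ≤ α.sum := by
  rcases le_total x α.length with h | h
  · have := take_sum_mono α h
    simpa using this
  · rw [List.take_of_length_le h]

theorem mem_alphaBlock {α : List ℕ} {x y : ℕ} :
    y ∈ alphaBlock α x ↔ (α.take (x - 1)).sum < y ∧ y ≤ (α.take x).sum := by
  simp [alphaBlock]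

theorem card_alphaBlock (α : List ℕ) {x : ℕ} (hx : 1 ≤ x) :
    (alphaBlock α x).card = α.getD (x - 1) 0 := by
  obtain ⟨m, rfl⟩ := Nat.exists_eq_add_of_le' hx
  simp [alphaBlock, take_sum_succ]

theorem blockOf_eq {α : List ℕ} {x y : ℕ} (h : y ∈ alphaBlock α x) : blockOf α y = x := by
  rw [mem_alphaBlock] at h
  apply le_antisymm
  · exact Nat.sInf_le h.2
  · have hmem : y ≤ (α.take (blockOf α y)).sum :=
      Nat.sInf_mem (s := {x : ℕ | y ≤ (α.take x).sum}) ⟨x, h.2⟩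
    by_contra! hlt
    have : (α.take (blockOf α y)).sum ≤ (α.take (x - 1)).sum := take_sum_mono α (by omega)
    omega

theorem mem_alphaBlock_blockOf {α : List ℕ} {y : ℕ} (h1 : 1 ≤ y) (h2 : y ≤ α.sum) :
    y ∈ alphaBlock α (blockOf α y) ∧ 1 ≤ blockOf α y ∧ blockOf α y ≤ α.length := by
  have hlen : y ≤ (α.take α.length).sum := by simpa using h2
  have hmem : y ≤ (α.take (blockOf α y)).sum :=
    Nat.sInf_mem (s := {x : ℕ | y ≤ (α.take x).sum}) ⟨_, hlen⟩
  have hpos : 1 ≤ blockOf α y := by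
    rw [Nat.one_le_iff_ne_zero]
    intro h
    rw [h] at hmem
    simp at hmem
    omega
  refine ⟨mem_alphaBlock.2 ⟨?_, hmem⟩, hpos, Nat.sInf_le hlen⟩
  have := Nat.notMem_of_lt_sInf (s := {x : ℕ | y ≤ (α.take x).sum}) (m := blockOf α y - 1)
    (show _ < blockOf α y by omega)
  simpa using this

theorem blockOf_mono {α : List ℕ} {y z : ℕ} (h : y ≤ z) (hz : z ≤ α.sum) :
    blockOf α y ≤ blockOf α z := by
  have hmem : z ≤ (α.take (blockOf α z)).sum :=
    Nat.sInf_mem (s := {x : ℕ | z ≤ (α.take x).sum}) ⟨α.length, by simpa using hz⟩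
  exact Nat.sInf_le (h.trans hmem)

/-! ## Standardization of `k`-tableaux -/

/-- The residues of the cells of `γ` labelled `x`. -/
noncomputable def labelRes (k : ℕ) (γ : YoungDiagram) (u : ℕ × ℕ → ℕ) (x : ℕ) :
    Finset (ZMod (k + 1)) :=
  (γ.cells.filter fun c => u c = x).image (residue k)

theorem mem_labelRes {k : ℕ} {γ : YoungDiagram} {u : ℕ × ℕ → ℕ} {x : ℕ} {r : ZMod (k + 1)} :
    r ∈ labelRes k γ u x ↔ ∃ c ∈ γ, u c = x ∧ residue k c = r := by
  simp [labelRes, and_assoc]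

/-- The letter of the cell `c` when, for each `x`, the cells of `γ` labelled `x` are relabelled by
the letters of the `x`-th block, according to the order on their residues given by `key x`. -/
noncomputable def stdLetter (k : ℕ) (α : List ℕ) (γ : YoungDiagram) (u : ℕ × ℕ → ℕ)
    (key : ℕ → ZMod (k + 1) → ℕ) (c : ℕ × ℕ) : ℕ :=
  (α.take (u c - 1)).sum +
    ((labelRes k γ u (u c)).filter fun r => key (u c) r ≤ key (u c) (residue k c)).card

theorem IsKTab.isSemistd {k : ℕ} {α : List ℕ} {γ : YoungDiagram} {u : ℕ × ℕ → ℕ}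
    (hu : IsKTab k α γ u) : IsSemistd γ u where
  up r c h := hu.2.2.1 r c (γ.up_left_mem (Nat.le_succ r) le_rfl h) h
  right r c h := hu.2.2.2.1 r c (γ.up_left_mem le_rfl (Nat.le_succ c) h) h

theorem IsKTab.card_labelRes {k : ℕ} {α : List ℕ} {γ : YoungDiagram} {u : ℕ × ℕ → ℕ}
    (hu : IsKTab k α γ u) {x : ℕ} (h1 : 1 ≤ x) (h2 : x ≤ α.length) :
    (labelRes k γ u x).card = α.getD (x - 1) 0 :=
  hu.2.2.2.2 x h1 h2

theorem IsKTab.pos {k : ℕ} {α : List ℕ} {γ : YoungDiagram} {u : ℕ × ℕ → ℕ}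
    (hu : IsKTab k α γ u) {c : ℕ × ℕ} (hc : c ∈ γ) : 1 ≤ u c :=
  Nat.one_le_iff_ne_zero.2 ((hu.1 c).1 hc)

section Standardization

variable {k : ℕ} {α : List ℕ} {γ : YoungDiagram} {u : ℕ × ℕ → ℕ} {key : ℕ → ZMod (k + 1) → ℕ}

theorem stdLetter_mem (hu : IsKTab k α γ u) {c : ℕ × ℕ} (hc : c ∈ γ) :
    stdLetter k α γ u key c ∈ alphaBlock α (u c) := by
  have h1 := hu.pos hc
  have hcard := hu.card_labelRes h1 (hu.2.1 c)
  rw [mem_alphaBlock]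
  have hS : (α.take (u c)).sum = (α.take (u c - 1)).sum + α.getD (u c - 1) 0 := by
    rw [← take_sum_succ, Nat.sub_add_cancel h1]
  unfold stdLetter
  constructor
  · refine Nat.lt_add_of_pos_right (Finset.card_pos.2 ⟨residue k c, ?_⟩)
    rw [Finset.mem_filter, mem_labelRes]
    exact ⟨⟨c, hc, rfl, rfl⟩, le_rfl⟩
  · rw [hS, ← hcard]
    exact Nat.add_le_add_left (Finset.card_filter_le _ _) _

theorem stdLetter_lt_of_key {c d : ℕ × ℕ} (hd : d ∈ γ) (he : u c = u d)
    (hlt : key (u c) (residue k c) < key (u c) (residue k d)) :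
    stdLetter k α γ u key c < stdLetter k α γ u key d := by
  unfold stdLetter
  rw [← he]
  refine Nat.add_lt_add_left (Finset.card_lt_card ?_) _
  rw [Finset.ssubset_iff_of_subset]
  · refine ⟨residue k d, ?_, ?_⟩
    · rw [Finset.mem_filter, mem_labelRes]
      exact ⟨⟨d, hd, he.symm, rfl⟩, le_rfl⟩
    · rw [Finset.mem_filter]
      exact fun h => absurd h.2 (not_le.2 hlt)
  · intro r hr
    rw [Finset.mem_filter] at hr ⊢
    exact ⟨hr.1, hr.2.trans hlt.le⟩

theorem stdLetter_congr {c d : ℕ × ℕ} (he : u c = u d) (hres : residue k c = residue k d) :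
    stdLetter k α γ u key c = stdLetter k α γ u key d := by
  unfold stdLetter
  rw [he, hres]

theorem key_lt_of_stdLetter_lt {c d : ℕ × ℕ} (he : u c = u d)
    (hlt : stdLetter k α γ u key c < stdLetter k α γ u key d) :
    key (u c) (residue k c) < key (u c) (residue k d) := by
  by_contra! hle
  refine absurd hlt (not_lt.2 ?_)
  unfold stdLetter
  rw [← he]
  refine Nat.add_le_add_left (Finset.card_le_card fun r hr => ?_) _
  rw [Finset.mem_filter] at hr ⊢
  exact ⟨hr.1, hr.2.trans hle⟩

theorem residue_eq_of_stdLetter_eq (hinj : ∀ x, Set.InjOn (key x) (labelRes k γ u x))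
    {c d : ℕ × ℕ} (hc : c ∈ γ) (hd : d ∈ γ) (he : u c = u d)
    (hcd : stdLetter k α γ u key c = stdLetter k α γ u key d) : residue k c = residue k d := by
  apply hinj (u c)
  · exact mem_labelRes.2 ⟨c, hc, rfl, rfl⟩
  · exact mem_labelRes.2 ⟨d, hd, he.symm, rfl⟩
  · rcases lt_trichotomy (key (u c) (residue k c)) (key (u c) (residue k d)) with h | h | h
    · exact absurd hcd (stdLetter_lt_of_key hd he h).ne
    · exact h
    · exact absurd hcd (stdLetter_lt_of_key hc he.symm (he ▸ h)).ne'

theorem blockOf_stdLetter (hu : IsKTab k α γ u) {c : ℕ × ℕ} (hc : c ∈ γ) :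
    blockOf α (stdLetter k α γ u key c) = u c :=
  blockOf_eq (stdLetter_mem hu hc)

theorem stdLetter_lt_of_lt (hu : IsKTab k α γ u) {c d : ℕ × ℕ} (hc : c ∈ γ) (hd : d ∈ γ)
    (hlt : u c < u d) : stdLetter k α γ u key c < stdLetter k α γ u key d := by
  have h1 := (mem_alphaBlock.1 (stdLetter_mem (key := key) hu hc)).2
  have h2 := (mem_alphaBlock.1 (stdLetter_mem (key := key) hu hd)).1
  have h3 : (α.take (u c)).sum ≤ (α.take (u d - 1)).sum := take_sum_mono α (by omega)
  omega

theorem isStdFilling_stdLetter (hu : IsKTab k α γ u)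
    (hinj : ∀ x, Set.InjOn (key x) (labelRes k γ u x))
    (hadj : ∀ i j, (i, j + 1) ∈ γ → u (i, j) = u (i, j + 1) →
      key (u (i, j)) (residue k (i, j)) < key (u (i, j)) (residue k (i, j + 1))) :
    ∃ ρ, IsStdFilling k α.sum γ (stdLetter k α γ u key) ρ := by
  refine ⟨fun y => if h : ∃ c ∈ γ, stdLetter k α γ u key c = y then residue k h.choose else 0,
    ?_, ?_, ?_, ?_, ?_⟩
  · intro c hc
    have := (mem_alphaBlock.1 (stdLetter_mem (key := key) hu hc)).1
    omega
  · intro c hc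
    exact (mem_alphaBlock.1 (stdLetter_mem (key := key) hu hc)).2.trans (take_sum_le α _)
  · intro i j h
    exact stdLetter_lt_of_lt hu (γ.up_left_mem (Nat.le_succ i) le_rfl h) h
      (hu.isSemistd.up i j h)
  · intro i j h
    rcases (hu.isSemistd.right i j h).eq_or_lt with he | hlt
    · exact stdLetter_lt_of_key h he (hadj i j h he)
    · exact stdLetter_lt_of_lt hu (γ.up_left_mem le_rfl (Nat.le_succ j) h) h hlt
  · intro c hc
    have hex : ∃ d ∈ γ, stdLetter k α γ u key d = stdLetter k α γ u key c := ⟨c, hc, rfl⟩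
    rw [dif_pos hex]
    obtain ⟨h1, h2⟩ := hex.choose_spec
    refine residue_eq_of_stdLetter_eq hinj hc h1 ?_ h2.symm
    rw [← blockOf_stdLetter (key := key) hu hc, ← blockOf_stdLetter (key := key) hu h1, h2]

end Standardization

theorem zmod_val_lt_val_add_one {k : ℕ} (hk : 1 ≤ k) {a : ZMod (k + 1)} (h : a + 1 ≠ 0) :
    a.val < (a + 1).val := by
  have : Fact (1 < k + 1) := ⟨by omega⟩
  have h1 : (a + 1).val = (a.val + 1) % (k + 1) := by
    rw [ZMod.val_add, ZMod.val_one]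
  have h2 := ZMod.val_lt a
  rcases (show a.val + 1 ≤ k + 1 by omega).eq_or_lt with h3 | h3
  · rw [h3, Nat.mod_self, ZMod.val_eq_zero] at h1
    exact absurd h1 h
  · rw [h1, Nat.mod_eq_of_lt h3]
    omega

theorem injOn_lowCol {k : ℕ} {γ : YoungDiagram} {u : ℕ × ℕ → ℕ} (hu : IsSemistd γ u) (x : ℕ) :
    Set.InjOn (lowCol k γ u x) (labelRes k γ u x) := by
  intro r hr r' hr' he
  obtain ⟨c, hc, rfl, rfl⟩ := mem_labelRes.1 (Finset.mem_coe.1 hr)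
  obtain ⟨d, hd, hdx, rfl⟩ := mem_labelRes.1 (Finset.mem_coe.1 hr')
  obtain ⟨c', hc', h1, h2, h3⟩ := exists_lowCol (k := k) (u := u) hc
  obtain ⟨d', hd', h4, h5, h6⟩ := exists_lowCol (k := k) (u := u) hd
  rw [hdx] at h6
  rw [← h2, ← h5, hu.eq_of_col hc' hd' (by omega) (by rw [h3, h6, he])]

/-- The standardization of a `k`-tableau by the lowest reading order is a standard filling. -/
theorem isStdFilling_lowCol {k : ℕ} (hk : 1 ≤ k) {α : List ℕ} (hα : IsKBoundedComp k α)
    {γ : YoungDiagram} (hγ : IsCore (k + 1) γ) (hsize : pSize k γ = α.sum) {u : ℕ × ℕ → ℕ}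
    (hu : IsKTab k α γ u) :
    ∃ ρ, IsStdFilling k α.sum γ (stdLetter k α γ u (lowCol k γ u)) ρ := by
  refine isStdFilling_stdLetter hu (injOn_lowCol hu.isSemistd) fun i j hij he => ?_
  have hmiss : ∀ x, ∃ s, 1 ≤ x → x ≤ α.length → s ∉ labelRes k γ u x := by
    intro x
    by_contra! h
    obtain ⟨h1, h2, -⟩ := h 0
    have huniv : labelRes k γ u x = Finset.univ := Finset.eq_univ_iff_forall.2 fun s => (h s).2.2
    have hcard := hu.card_labelRes h1 h2
    rw [huniv, Finset.card_univ, ZMod.card, List.getD_eq_getElem _ _ (by omega)] at hcard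
    have := (hα _ (List.getElem_mem (show x - 1 < α.length by omega))).2
    omega
  choose s hs using hmiss
  obtain ⟨ρ, hρ⟩ := isStdFilling_stdLetter (key := fun x r => (r - s x).val) hu
    (fun x r _ r' _ h => sub_left_injective (ZMod.val_injective _ h)) (by
      intro i j hij he
      have h1 : residue k (i, j + 1) - s (u (i, j)) = residue k (i, j) - s (u (i, j)) + 1 := by
        simp only [residue]
        push_cast
        ring
      rw [h1]
      apply zmod_val_lt_val_add_one hk
      rw [← h1, sub_ne_zero]
      rintro h
      refine hs (u (i, j)) ?_ (hu.2.1 _) (mem_labelRes.2 ⟨_, hij, he.symm, h⟩)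
      rw [he]
      exact hu.pos hij)
  have hmem := stdLetter_mem (key := fun x r => (r - s x).val) hu hij
  rw [← he, mem_alphaBlock] at hmem
  obtain ⟨δ, hδ, hδmem, -⟩ := hρ.exists_core hk hγ hsize (y := (α.take (u (i, j))).sum)
    (by omega) (take_sum_le α _)
  refine lowCol_lt_of_adjacent hk hu.isSemistd hij he hδ fun c => ?_
  rw [hδmem]
  refine and_congr_right fun hc => ?_
  have h := mem_alphaBlock.1 (stdLetter_mem (key := fun x r => (r - s x).val) hu hc)
  constructor
  · intro h1
    by_contra! h2
    have : (α.take (u (i, j))).sum ≤ (α.take (u c - 1)).sum := take_sum_mono α (by omega)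
    omega
  · intro h1
    exact h.2.trans (take_sum_mono α h1)

/-! ## Affine set-valued tableaux of maximal degree -/

theorem IsStdASVT.exists_letters {k : ℕ} (hk : 1 ≤ k) {n : ℕ} {γ : YoungDiagram}
    (hγ : IsCore (k + 1) γ) (hsize : pSize k γ = n) {e : ℕ × ℕ → Finset ℕ}
    (he : IsStdASVT k n γ e) :
    ∃ w ρ, (∀ c y, y ∈ e c ↔ c ∈ γ ∧ w c = y) ∧ IsStdFilling k n γ w ρ := by
  obtain ⟨⟨hne, hpos, hup, hright⟩, hle, hx⟩ := he
  choose! δ hδ hcells i hex hocc using hx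
  set v : ℕ × ℕ → ℕ := fun c => sInf (e c : Set ℕ) with hvdef
  have hmem : ∀ c ∈ γ, v c ∈ e c := fun c hc =>
    Finset.mem_coe.1 (Nat.sInf_mem (Finset.coe_nonempty.2 ((hne c).1 hc)))
  have hmin : ∀ c, ∀ y ∈ e c, v c ≤ y := fun c y hy => Nat.sInf_le (Finset.mem_coe.2 hy)
  have hδmem : ∀ x, 1 ≤ x → x ≤ n → ∀ c, c ∈ δ x ↔ c ∈ γ ∧ v c ≤ x := by
    intro x h1 h2 c
    rw [← YoungDiagram.mem_cells, hcells x h1 h2, shapeLe, Finset.mem_filter,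
      YoungDiagram.mem_cells]
    refine and_congr_right fun hc => ⟨?_, fun h => ⟨v c, hmem c hc, h⟩⟩
    rintro ⟨y, hy, hyx⟩
    exact (hmin c y hy).trans hyx
  have hv : IsStdFilling k n γ v i := by
    refine ⟨fun c hc => hpos c _ (hmem c hc), fun c hc => hle c _ (hmem c hc), ?_, ?_, ?_⟩
    · intro r c h
      exact hup r c _ (hmem _ (γ.up_left_mem (Nat.le_succ r) le_rfl h)) _ (hmem _ h)
    · intro r c h
      have h' := γ.up_left_mem le_rfl (Nat.le_succ c) h
      refine lt_of_le_of_ne (hright r c _ (hmem _ h') _ (hmem _ h)) fun heq => ?_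
      have h1 := hpos _ _ (hmem _ h')
      have h2 := hle _ _ (hmem _ h')
      have h3 := ((hocc _ h1 h2 _).1 (hmem _ h')).1
      exact h3.2.2 ((hδmem _ h1 h2 _).2 ⟨h, heq.ge⟩)
    · intro c hc
      exact ((hocc _ (hpos _ _ (hmem c hc)) (hle _ _ (hmem c hc)) c).1 (hmem c hc)).2
  refine ⟨v, i, fun c y => ⟨fun hy => ?_, ?_⟩, hv⟩
  · have h1 := hpos c y hy
    have h2 := hle c y hy
    obtain ⟨δ', -, hδ', -, hrem⟩ := hv.exists_core hk hγ hsize h1 h2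
    have heq : δ' = δ y := by
      ext c
      rw [YoungDiagram.mem_cells, YoungDiagram.mem_cells, hδ', hδmem y h1 h2]
    rw [hrem, heq]
    exact (hocc y h1 h2 c).1 hy
  · rintro ⟨hc, rfl⟩
    exact hmem c hc

/-- Replace the letters of each block by the index of the block. -/
noncomputable def collapse (α : List ℕ) (e : ℕ × ℕ → Finset ℕ) (c : ℕ × ℕ) : ℕ :=
  blockOf α ((e c).sup id)

theorem IsSemistd.readBefore_iff {γ : YoungDiagram} {u : ℕ × ℕ → ℕ} (hu : IsSemistd γ u)
    {c d : ℕ × ℕ} (hc : c ∈ γ) (hd : d ∈ γ) (he : u c = u d) : ReadBefore c d ↔ c.2 < d.2 := by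
  constructor
  · rintro (h | h)
    · by_contra! hle
      have := hu.row_le hc he.symm hle
      omega
    · exact h.2
  · intro h
    exact (hu.row_le hd he h.le).lt_or_eq.imp id fun h' => ⟨h'.symm, h⟩

section SingletonFillings

variable {k : ℕ} {α : List ℕ} {γ : YoungDiagram} {e : ℕ × ℕ → Finset ℕ} {w : ℕ × ℕ → ℕ}
  {ρ : ℕ → ZMod (k + 1)}

theorem collapse_of_mem (he : ∀ c y, y ∈ e c ↔ c ∈ γ ∧ w c = y) {c : ℕ × ℕ} (hc : c ∈ γ) :
    collapse α e c = blockOf α (w c) := by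
  have : e c = {w c} := by
    ext y
    simp [he, hc, eq_comm]
  simp [collapse, this]

theorem collapse_of_notMem (he : ∀ c y, y ∈ e c ↔ c ∈ γ ∧ w c = y) {c : ℕ × ℕ} (hc : c ∉ γ) :
    collapse α e c = 0 := by
  have : e c = ∅ := by
    ext y
    simp [he, hc]
  rw [collapse, this, Finset.sup_empty, ← Nat.le_zero]
  exact Nat.sInf_le (Nat.zero_le _)

theorem exists_mem_alphaBlock_iff (he : ∀ c y, y ∈ e c ↔ c ∈ γ ∧ w c = y)
    (hv : IsStdFilling k α.sum γ w ρ) {c : ℕ × ℕ} {x : ℕ} :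
    (∃ y ∈ alphaBlock α x, y ∈ e c) ↔ c ∈ γ ∧ collapse α e c = x := by
  constructor
  · rintro ⟨y, hy, hyc⟩
    obtain ⟨hc, rfl⟩ := (he c y).1 hyc
    exact ⟨hc, by rw [collapse_of_mem he hc, blockOf_eq hy]⟩
  · rintro ⟨hc, rfl⟩
    refine ⟨w c, ?_, (he c _).2 ⟨hc, rfl⟩⟩
    rw [collapse_of_mem he hc]
    exact (mem_alphaBlock_blockOf (hv.pos c hc) (hv.le c hc)).1

theorem image_residue_eq_labelRes (he : ∀ c y, y ∈ e c ↔ c ∈ γ ∧ w c = y)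
    (hv : IsStdFilling k α.sum γ w ρ) (x : ℕ) :
    (γ.cells.filter fun c => ∃ y ∈ alphaBlock α x, y ∈ e c).image (residue k) =
      labelRes k γ (collapse α e) x := by
  unfold labelRes
  congr 1
  refine Finset.filter_congr fun c hc => ?_
  rw [exists_mem_alphaBlock_iff he hv]
  exact and_iff_right ((YoungDiagram.mem_cells _).1 hc)

theorem isLowestOcc_iff (he : ∀ c y, y ∈ e c ↔ c ∈ γ ∧ w c = y)
    (hv : IsStdFilling k α.sum γ w ρ) {u : ℕ × ℕ → ℕ} (hu : IsSemistd γ u)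
    (hw : ∀ c ∈ γ, ∀ d ∈ γ, w c = w d ↔ u c = u d ∧ residue k c = residue k d)
    {y : ℕ} {c : ℕ × ℕ} :
    IsLowestOcc e y c ↔ c ∈ γ ∧ w c = y ∧ c.2 = lowCol k γ u (u c) (residue k c) := by
  constructor
  · rintro ⟨hy, hlow⟩
    obtain ⟨hc, rfl⟩ := (he c y).1 hy
    refine ⟨hc, rfl, ?_⟩
    obtain ⟨d, hd, h1, h2, h3⟩ := exists_lowCol (k := k) (u := u) hc
    have hcd : w d = w c := (hw d hd c hc).2 ⟨h1, h2⟩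
    have h4 := hlow d ((he _ _).2 ⟨hd, hcd⟩)
    have h5 := le_lowCol (k := k) (u := u) hc
    rw [← h3] at h5 ⊢
    by_contra hne
    have h6 := hv.lt_of_le hd (show c ≤ d from ⟨h4, h5⟩) (fun h => hne (h ▸ rfl))
    omega
  · rintro ⟨hc, rfl, hcol⟩
    refine ⟨(he _ _).2 ⟨hc, rfl⟩, fun d hd => ?_⟩
    obtain ⟨hd, hcd⟩ := (he _ _).1 hd
    obtain ⟨h1, h2⟩ := (hw d hd c hc).1 hcd
    refine hu.row_le hc h1 ?_
    rw [hcol, ← h1, ← h2]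
    exact le_lowCol hd

theorem isKTab_collapse (he : ∀ c y, y ∈ e c ↔ c ∈ γ ∧ w c = y)
    (hv : IsStdFilling k α.sum γ w ρ) (hT : IsASVT k α γ e) :
    IsKTab k α γ (collapse α e) := by
  have hb : ∀ c ∈ γ, w c ∈ alphaBlock α (collapse α e c) ∧ 1 ≤ collapse α e c ∧
      collapse α e c ≤ α.length := by
    intro c hc
    rw [collapse_of_mem he hc]
    exact mem_alphaBlock_blockOf (hv.pos c hc) (hv.le c hc)
  refine ⟨fun c => ⟨fun hc => ?_, fun h => ?_⟩, fun c => ?_, ?_, ?_, ?_⟩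
  · exact Nat.one_le_iff_ne_zero.1 (hb c hc).2.1
  · by_contra hc
    exact h (collapse_of_notMem he hc)
  · by_cases hc : c ∈ γ
    · exact (hb c hc).2.2
    · rw [collapse_of_notMem he hc]
      exact Nat.zero_le _
  · intro r c h1 h2
    have hle : collapse α e (r, c) ≤ collapse α e (r + 1, c) := by
      rw [collapse_of_mem he h1, collapse_of_mem he h2]
      exact blockOf_mono (hv.up r c h2).le (hv.le _ h2)
    refine lt_of_le_of_ne hle fun heq => ?_
    have := (hT.2 _ (hb _ h1).2.1 (hb _ h1).2.2).2.2 (r, c) (r + 1, c)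
      ((exists_mem_alphaBlock_iff he hv).2 ⟨h1, rfl⟩)
      ((exists_mem_alphaBlock_iff he hv).2 ⟨h2, heq.symm⟩) rfl
    simp at this
  · intro r c h1 h2
    rw [collapse_of_mem he h1, collapse_of_mem he h2]
    exact blockOf_mono (hv.right r c h2).le (hv.le _ h2)
  · intro x h1 h2
    rw [← (hT.2 x h1 h2).2.1, image_residue_eq_labelRes he hv]
    rfl

theorem isASVT_of_lowCol (hk : 1 ≤ k) (hγ : IsCore (k + 1) γ) (hsize : pSize k γ = α.sum)
    (he : ∀ c y, y ∈ e c ↔ c ∈ γ ∧ w c = y) (hv : IsStdFilling k α.sum γ w ρ)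
    (hu : IsKTab k α γ (collapse α e))
    (hw : w = stdLetter k α γ (collapse α e) (lowCol k γ (collapse α e))) :
    IsASVT k α γ e := by
  have hcl : ∀ c ∈ γ, ∀ d ∈ γ, w c = w d ↔
      collapse α e c = collapse α e d ∧ residue k c = residue k d := by
    intro c hc d hd
    constructor
    · intro h
      have h1 : collapse α e c = collapse α e d := by
        rw [collapse_of_mem he hc, collapse_of_mem he hd, h]
      rw [hw] at h
      exact ⟨h1, residue_eq_of_stdLetter_eq (injOn_lowCol hu.isSemistd) hc hd h1 h⟩
    · intro h
      rw [hw]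
      exact stdLetter_congr h.1 h.2
  refine ⟨⟨⟨fun c => ?_, fun c x hx => ?_, fun r c x hx y hy => ?_, fun r c x hx y hy => ?_⟩,
    fun c y hy => ?_, fun x h1 h2 => ?_⟩, fun x h1 h2 => ⟨?_, ?_, ?_⟩⟩
  · exact ⟨fun hc => ⟨w c, (he _ _).2 ⟨hc, rfl⟩⟩, fun ⟨y, hy⟩ => ((he _ _).1 hy).1⟩
  · obtain ⟨hc, rfl⟩ := (he _ _).1 hx
    exact hv.pos c hc
  · obtain ⟨hc, rfl⟩ := (he _ _).1 hx
    obtain ⟨hd, rfl⟩ := (he _ _).1 hy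
    exact hv.up r c hd
  · obtain ⟨hc, rfl⟩ := (he _ _).1 hx
    obtain ⟨hd, rfl⟩ := (he _ _).1 hy
    exact (hv.right r c hd).le
  · obtain ⟨hc, rfl⟩ := (he _ _).1 hy
    exact hv.le c hc
  · obtain ⟨δ, hδ, hmem, ⟨c₀, hc₀⟩, hrem⟩ := hv.exists_core hk hγ hsize h1 h2
    refine ⟨δ, hδ, ?_, ρ x, ⟨c₀, (he _ _).2 hc₀⟩, fun c => (he c x).trans (hrem c)⟩
    ext c
    rw [YoungDiagram.mem_cells, hmem, shapeLe, Finset.mem_filter, YoungDiagram.mem_cells]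
    refine and_congr_right fun hc => ?_
    simp [he, hc]
  · intro y z hy hz hyz cy cz hcy hcz
    obtain ⟨hcyγ, rfl, hy2⟩ := (isLowestOcc_iff he hv hu.isSemistd hcl).1 hcy
    obtain ⟨hczγ, rfl, hz2⟩ := (isLowestOcc_iff he hv hu.isSemistd hcl).1 hcz
    have heq : collapse α e cy = collapse α e cz := by
      rw [collapse_of_mem he hcyγ, collapse_of_mem he hczγ, blockOf_eq hy, blockOf_eq hz]
    rw [hu.isSemistd.readBefore_iff hcyγ hczγ heq, hy2, hz2, ← heq]
    rw [hw] at hyz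
    exact key_lt_of_stdLetter_lt heq hyz
  · rw [image_residue_eq_labelRes he hv]
    exact hu.card_labelRes h1 h2
  · intro c d hc hd
    obtain ⟨hcγ, hcx⟩ := (exists_mem_alphaBlock_iff he hv).1 hc
    obtain ⟨hdγ, hdx⟩ := (exists_mem_alphaBlock_iff he hv).1 hd
    exact hu.isSemistd.eq_of_col hcγ hdγ (hcx.trans hdx.symm)

/-- The letters of an affine set-valued tableau of maximal degree are determined by its
collapse. -/
theorem eq_stdLetter_collapse (hk : 1 ≤ k) (hγ : IsCore (k + 1) γ) (hsize : pSize k γ = α.sum)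
    (he : ∀ c y, y ∈ e c ↔ c ∈ γ ∧ w c = y) (hv : IsStdFilling k α.sum γ w ρ)
    (hT : IsASVT k α γ e) {c : ℕ × ℕ} (hc : c ∈ γ) :
    w c = stdLetter k α γ (collapse α e) (lowCol k γ (collapse α e)) c := by
  have hu := isKTab_collapse he hv hT
  have hb : ∀ c ∈ γ, w c ∈ alphaBlock α (collapse α e c) := by
    intro c hc
    rw [collapse_of_mem he hc]
    exact (mem_alphaBlock_blockOf (hv.pos c hc) (hv.le c hc)).1
  have hex : ∀ x, ∀ y ∈ alphaBlock α x, ∃ d ∈ γ, w d = y ∧ collapse α e d = x := by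
    intro x y hy
    have h1 := mem_alphaBlock.1 hy
    obtain ⟨-, -, -, ⟨d, hd, rfl⟩, -⟩ := hv.exists_core hk hγ hsize (y := y) (by omega)
      (h1.2.trans (take_sum_le α x))
    exact ⟨d, hd, rfl, by rw [collapse_of_mem he hd, blockOf_eq hy]⟩
  have himage : ∀ x, labelRes k γ (collapse α e) x = (alphaBlock α x).image ρ := by
    intro x
    ext r
    rw [mem_labelRes, Finset.mem_image]
    constructor
    · rintro ⟨d, hd, rfl, rfl⟩
      exact ⟨w d, hb d hd, (hv.res d hd).symm⟩
    · rintro ⟨y, hy, rfl⟩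
      obtain ⟨d, hd, rfl, hdx⟩ := hex x y hy
      exact ⟨d, hd, hdx, hv.res d hd⟩
  have hinj : ∀ d ∈ γ, Set.InjOn ρ (alphaBlock α (collapse α e d)) := by
    intro d hd
    rw [← Finset.card_image_iff, ← himage, hu.card_labelRes (hu.pos hd) (hu.2.1 d),
      card_alphaBlock α (hu.pos hd)]
  have hcl : ∀ c ∈ γ, ∀ d ∈ γ, w c = w d ↔
      collapse α e c = collapse α e d ∧ residue k c = residue k d := by
    intro c hc d hd
    constructor
    · intro h
      rw [collapse_of_mem he hc, collapse_of_mem he hd, hv.res c hc, hv.res d hd, h]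
      exact ⟨rfl, rfl⟩
    · rintro ⟨h1, h2⟩
      rw [hv.res c hc, hv.res d hd] at h2
      exact hinj c hc (hb c hc) (h1 ▸ hb d hd) h2
  have hmono : StrictMonoOn (fun y => lowCol k γ (collapse α e) (collapse α e c) (ρ y))
      (alphaBlock α (collapse α e c)) := by
    intro y hy z hz hyz
    have hlow : ∀ y ∈ alphaBlock α (collapse α e c), ∃ d ∈ γ, IsLowestOcc e y d ∧
        collapse α e d = collapse α e c ∧
        d.2 = lowCol k γ (collapse α e) (collapse α e c) (ρ y) := by
      intro y hy
      obtain ⟨d, hd, rfl, hdx⟩ := hex _ y hy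
      obtain ⟨d', hd', h1, h2, h3⟩ := exists_lowCol (k := k) (u := collapse α e) hd
      refine ⟨d', hd', (isLowestOcc_iff he hv hu.isSemistd hcl).2
        ⟨hd', (hcl d' hd' d hd).2 ⟨h1, h2⟩, by rw [h1, h2, h3]⟩, h1.trans hdx, ?_⟩
      rw [h3, hdx, hv.res d hd]
    obtain ⟨cy, hcy, hy1, hy2, hy3⟩ := hlow y hy
    obtain ⟨cz, hcz, hz1, hz2, hz3⟩ := hlow z hz
    have := (hT.2 _ (hu.pos hc) (hu.2.1 c)).1 y z hy hz hyz cy cz hy1 hz1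
    rw [hu.isSemistd.readBefore_iff hcy hcz (hy2.trans hz2.symm), hy3, hz3] at this
    exact this
  have hcb := hb c hc
  have hfilter : ((labelRes k γ (collapse α e) (collapse α e c)).filter fun r =>
      lowCol k γ (collapse α e) (collapse α e c) r ≤
        lowCol k γ (collapse α e) (collapse α e c) (residue k c)) =
      (Finset.Ioc ((α.take (collapse α e c - 1)).sum) (w c)).image ρ := by
    rw [himage, Finset.filter_image, hv.res c hc]
    congr 1
    ext y
    rw [Finset.mem_filter, Finset.mem_Ioc]
    have h1 := mem_alphaBlock.1 hcb
    constructor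
    · rintro ⟨h2, h3⟩
      exact ⟨(mem_alphaBlock.1 h2).1, (hmono.le_iff_le h2 hcb).1 h3⟩
    · rintro ⟨h2, h3⟩
      have h4 : y ∈ alphaBlock α (collapse α e c) := mem_alphaBlock.2 ⟨h2, h3.trans h1.2⟩
      exact ⟨h4, (hmono.le_iff_le h4 hcb).2 h3⟩
  have h1 := mem_alphaBlock.1 hcb
  rw [stdLetter, hfilter, Finset.card_image_of_injOn, Nat.card_Ioc]
  · omega
  · refine (hinj c hc).mono fun y hy => ?_
    have h2 := Finset.mem_Ioc.1 (Finset.mem_coe.1 hy)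
    exact Finset.mem_coe.2 (mem_alphaBlock.2 ⟨h2.1, h2.2.trans h1.2⟩)

end SingletonFillings

theorem bijOn_collapse {k : ℕ} (hk : 1 ≤ k) {α : List ℕ} (hα : IsKBoundedComp k α)
    {γ : YoungDiagram} (hγ : IsCore (k + 1) γ) (hsize : pSize k γ = α.sum) :
    Set.BijOn (collapse α) {e | IsASVT k α γ e} {u | IsKTab k α γ u} := by
  refine ⟨fun e hT => ?_, fun e hT e' hT' heq => ?_, fun u hu => ?_⟩
  · have hT : IsASVT k α γ e := hT
    obtain ⟨w, ρ, he, hv⟩ := hT.1.exists_letters hk hγ hsize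
    exact isKTab_collapse he hv hT
  · have hT : IsASVT k α γ e := hT
    have hT' : IsASVT k α γ e' := hT'
    obtain ⟨w, ρ, he, hv⟩ := hT.1.exists_letters hk hγ hsize
    obtain ⟨w', ρ', he', hv'⟩ := hT'.1.exists_letters hk hγ hsize
    ext c y
    rw [he, he']
    refine and_congr_right fun hc => ?_
    rw [eq_stdLetter_collapse hk hγ hsize he hv hT hc,
      eq_stdLetter_collapse hk hγ hsize he' hv' hT' hc, heq]
  · have hu : IsKTab k α γ u := hu
    obtain ⟨ρ, hv⟩ := isStdFilling_lowCol hk hα hγ hsize hu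
    set w := stdLetter k α γ u (lowCol k γ u) with hw
    have he : ∀ c y, y ∈ (if c ∈ γ then ({w c} : Finset ℕ) else ∅) ↔ c ∈ γ ∧ w c = y := by
      intro c y
      by_cases hc : c ∈ γ <;> simp [hc, eq_comm]
    have hcol : collapse α (fun c => if c ∈ γ then ({w c} : Finset ℕ) else ∅) = u := by
      funext c
      by_cases hc : c ∈ γ
      · rw [collapse_of_mem he hc, hw, blockOf_stdLetter hu hc]
      · rw [collapse_of_notMem he hc]
        by_contra h
        exact hc ((hu.1 c).2 (Ne.symm h))
    refine ⟨_, ?_, hcol⟩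
    refine isASVT_of_lowCol hk hγ hsize he hv ?_ ?_
    · rwa [hcol]
    · rw [hcol]

/-- Let `λ` be a `k`-bounded partition and `α` a `k`-bounded composition with
`|α| = |λ|`.  Then every `T ∈ 𝒯^k_α(λ)` has all its cells filled with singleton sets, and the
map that replaces each letter of `𝒜_{α,x}` by `x` is a bijection from `𝒯^k_α(λ)` onto the set
of `k`-tableaux of shape `𝔠(λ)` and weight `α`; in particular `𝒦^{(k)}_{λα} = K^{(k)}_{λα}`. -/
theorem asvt_eq_ktableaux_of_equal_degree
    (k : ℕ) (hk : 1 ≤ k) (lam : YoungDiagram) (hlam : IsKBounded k lam)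
    (α : List ℕ) (hα : IsKBoundedComp k α) (hsum : α.sum = lam.card) :
    (∀ e : ℕ × ℕ → Finset ℕ, IsASVT k α (coreOf k lam) e →
      ∀ c : ℕ × ℕ, c ∈ coreOf k lam → (e c).card = 1) ∧
    Set.BijOn (fun (e : ℕ × ℕ → Finset ℕ) => fun c => blockOf α ((e c).sup id))
      {e | IsASVT k α (coreOf k lam) e} {u | IsKTab k α (coreOf k lam) u} ∧
    Kcal k lam α = Kktab k lam α := by
  obtain ⟨hγ, -⟩ := coreOf_spec hlam
  have hsize : pSize k (coreOf k lam) = α.sum := (pSize_coreOf hlam).trans hsum.symm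
  have hbij := bijOn_collapse hk hα hγ hsize
  refine ⟨fun e hT c hc => ?_, hbij, Nat.card_congr (Set.BijOn.equiv _ hbij)⟩
  obtain ⟨w, ρ, he, -⟩ := hT.1.exists_letters hk hγ hsize
  rw [Finset.card_eq_one]
  exact ⟨w c, by ext y; simp [he, hc, eq_comm]⟩

end AffineKTheory
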